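/- Let λ and μ be partitions with at most n parts. The number of Yamanouchi semistandard set-valued tableaux in SVT^n(λ) of weight μ equals the number of flagged increasing tableaux of shape μ/λ; in particular this number is zero unless λ ⊆ μ. -/

import Mathlib

open scoped Classical

noncomputable section

namespace SVTCrystal

/-- A filling assigns to each (row, column) position (0-indexed) a finite set of entries. -/
abbrev Filling : Type := ℕ → ℕ → Finset ℕ

/-- `lam` is a partition shape with at most `n` rows. -/
def IsPartitionShape (n : ℕ) (lam : ℕ → ℕ) : Prop :=
  (∀ r, lam (r + 1) ≤ lam r) ∧ (∀ r, n ≤ r → lam r = 0)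

/-- Semistandard set-valued tableau of shape `lam` with entries in `{1,…,n}`. -/
structure IsSVT (n : ℕ) (lam : ℕ → ℕ) (t : Filling) : Prop where
  boxNonempty : ∀ r c, c < lam r → (t r c).Nonempty
  emptyOutside : ∀ r c, ¬ c < lam r → t r c = ∅
  entryBounds : ∀ r c a, a ∈ t r c → 1 ≤ a ∧ a ≤ n
  rowWeak : ∀ r c a b, a ∈ t r c → b ∈ t r (c + 1) → a ≤ b
  colStrict : ∀ r c a b, a ∈ t r c → b ∈ t (r + 1) c → a < b

/-- Semistandard Young tableau: a set-valued tableau all of whose boxes are singletons. -/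
def IsSSYT (n : ℕ) (lam : ℕ → ℕ) (t : Filling) : Prop :=
  IsSVT n lam t ∧ ∀ r c, c < lam r → (t r c).card = 1

/-- The weight: `wt n lam t j` is the number of boxes of `t` containing the entry `j`. -/
def wt (n : ℕ) (lam : ℕ → ℕ) (t : Filling) (j : ℕ) : ℕ :=
  ((Finset.range n ×ˢ Finset.range (lam 0)).filter (fun p => j ∈ t p.1 p.2)).card

/-- The excess: total number of extra entries. -/
def excess (n : ℕ) (lam : ℕ → ℕ) (t : Filling) : ℕ :=
  ∑ p ∈ Finset.range n ×ˢ Finset.range (lam 0), ((t p.1 p.2).card - 1)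

/-- Column `c` contains the entry `a`. -/
def colHas (n : ℕ) (t : Filling) (a c : ℕ) : Prop := ∃ r, r < n ∧ a ∈ t r c

/-- The sign of column `c` for the `i`-signature rule: `+` (true) if the column contains `i`
but not `i+1`, `-` (false) if it contains `i+1` but not `i`. -/
def colSign (n : ℕ) (t : Filling) (i c : ℕ) : Option Bool :=
  if colHas n t i c ∧ ¬ colHas n t (i + 1) c then some true
  else if colHas n t (i + 1) c ∧ ¬ colHas n t i c then some false
  else none

/-- The number of `-` (false) signs left uncanceled after scanning the word left-to-right,
iteratively canceling `-+` pairs. -/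
def mctr (w : List Bool) : ℕ := w.foldl (fun cnt b => if b then cnt - 1 else cnt + 1) 0

/-- The number of `+` (true) signs left uncanceled, scanning right-to-left. -/
def pctr (w : List Bool) : ℕ := w.foldr (fun b cnt => if b then cnt + 1 else cnt - 1) 0

/-- The word of column signs of the columns before column `c`. -/
def colWordBefore (n : ℕ) (t : Filling) (i c : ℕ) : List Bool :=
  (List.range c).filterMap (colSign n t i)

/-- The word of column signs of the columns after column `c` (among columns `< ncols`). -/
def colWordAfter (n ncols : ℕ) (t : Filling) (i c : ℕ) : List Bool :=
  ((List.range ncols).drop (c + 1)).filterMap (colSign n t i)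

/-- Column `c` carries an uncanceled `+` for the `i`-signature rule. -/
def PlusCol (n ncols : ℕ) (t : Filling) (i c : ℕ) : Prop :=
  c < ncols ∧ colSign n t i c = some true ∧ mctr (colWordBefore n t i c) = 0

/-- Column `c` carries an uncanceled `-` for the `i`-signature rule. -/
def MinusCol (n ncols : ℕ) (t : Filling) (i c : ℕ) : Prop :=
  c < ncols ∧ colSign n t i c = some false ∧ pctr (colWordAfter n ncols t i c) = 0

/-- Column `c` is the rightmost uncanceled `+`. -/
def fBoxCol (n ncols : ℕ) (t : Filling) (i c : ℕ) : Prop :=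
  PlusCol n ncols t i c ∧ ∀ c', PlusCol n ncols t i c' → c' ≤ c

/-- Column `c` is the leftmost uncanceled `-`. -/
def eBoxCol (n ncols : ℕ) (t : Filling) (i c : ℕ) : Prop :=
  MinusCol n ncols t i c ∧ ∀ c', MinusCol n ncols t i c' → c ≤ c'

/-- Replace the content of the box in row `r`, column `c` by `A`. -/
def updateBox (t : Filling) (r c : ℕ) (A : Finset ℕ) : Filling :=
  fun r' c' => if r' = r ∧ c' = c then A else t r' c'

/-- The set-valued crystal operator `f_i` (signature rule). -/
def fRaw (n : ℕ) (lam : ℕ → ℕ) (i : ℕ) (t : Filling) : Option Filling :=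
  if h : ∃ c, fBoxCol n (lam 0) t i c then
    let c := Classical.choose h
    if hr : ∃ r, r < n ∧ i ∈ t r c then
      let r := Classical.choose hr
      if i ∈ t r (c + 1) then
        some (updateBox (updateBox t r (c + 1) ((t r (c + 1)).erase i)) r c
          (insert (i + 1) (t r c)))
      else some (updateBox t r c (insert (i + 1) ((t r c).erase i)))
    else none
  else none

/-- The set-valued crystal operator `e_i` (signature rule). -/
def eRaw (n : ℕ) (lam : ℕ → ℕ) (i : ℕ) (t : Filling) : Option Filling :=
  if h : ∃ c, eBoxCol n (lam 0) t i c then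
    let c := Classical.choose h
    if hr : ∃ r, r < n ∧ (i + 1) ∈ t r c then
      let r := Classical.choose hr
      if 0 < c ∧ (i + 1) ∈ t r (c - 1) then
        some (updateBox (updateBox t r (c - 1) ((t r (c - 1)).erase (i + 1))) r c
          (insert i (t r c)))
      else some (updateBox t r c (insert i ((t r c).erase (i + 1))))
    else none
  else none

/-- Iterate a partially-defined operator. -/
def iterOpt (g : Filling → Option Filling) : ℕ → Filling → Option Filling
  | 0, t => some t
  | m + 1, t => (iterOpt g m t).bind g

/-- Highest weight (Yamanouchi) elements. -/
def IsYamanouchi (n : ℕ) (lam : ℕ → ℕ) (t : Filling) : Prop :=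
  ∀ i, 1 ≤ i → i < n → eRaw n lam i t = none

/-- Closure of `t0` under the crystal operators `e_i`, `f_i` for `1 ≤ i < n`. -/
inductive Reach (n : ℕ) (lam : ℕ → ℕ) (t0 : Filling) : Filling → Prop
  | base : Reach n lam t0 t0
  | stepF : ∀ {t t' : Filling} (i : ℕ), 1 ≤ i → i < n → Reach n lam t0 t →
      fRaw n lam i t = some t' → Reach n lam t0 t'
  | stepE : ∀ {t t' : Filling} (i : ℕ), 1 ≤ i → i < n → Reach n lam t0 t →
      eRaw n lam i t = some t' → Reach n lam t0 t'

/-- The one-row partition `(s)`. -/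
def rowShape (s : ℕ) : ℕ → ℕ := fun r => if r = 0 then s else 0

/-- The one-column partition `(1^k)`. -/
def colShape (k : ℕ) : ℕ → ℕ := fun r => if r < k then 1 else 0

/-- The hook partition `(s, 1^e)`. -/
def hookShape (s e : ℕ) : ℕ → ℕ := fun r => if r = 0 then s else if r ≤ e then 1 else 0

/-! ### K-theory crystal operators (for single rows and single columns) -/

/-- Some box of the tableau contains the entry `a`. -/
def containsEntry (n : ℕ) (lam : ℕ → ℕ) (t : Filling) (a : ℕ) : Prop :=
  ∃ r c, r < n ∧ c < lam r ∧ a ∈ t r c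

/-- `p` is the rightmost box of `t` containing `i`. -/
def KBoxF (n : ℕ) (lam : ℕ → ℕ) (t : Filling) (i : ℕ) (p : ℕ × ℕ) : Prop :=
  p.1 < n ∧ p.2 < lam p.1 ∧ i ∈ t p.1 p.2 ∧
    ∀ q : ℕ × ℕ, q.1 < n → q.2 < lam q.1 → i ∈ t q.1 q.2 → q.2 ≤ p.2

/-- The K-crystal operator `f_i^K`: if `i` occurs in `t` and `i+1` does not, add `i+1` to
the rightmost box containing `i`; otherwise `0`. -/
def fK (n : ℕ) (lam : ℕ → ℕ) (i : ℕ) (t : Filling) : Option Filling :=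
  if h : (∃ p : ℕ × ℕ, KBoxF n lam t i p) ∧ ¬ containsEntry n lam t (i + 1) then
    let p := Classical.choose h.1
    some (updateBox t p.1 p.2 (insert (i + 1) (t p.1 p.2)))
  else none

/-- The K-crystal operator `e_i^K`: delete `i+1` from the box containing both `i` and `i+1`,
if such a box exists; otherwise `0`. -/
def eK (n : ℕ) (lam : ℕ → ℕ) (i : ℕ) (t : Filling) : Option Filling :=
  if h : ∃ p : ℕ × ℕ, p.1 < n ∧ p.2 < lam p.1 ∧ i ∈ t p.1 p.2 ∧ (i + 1) ∈ t p.1 p.2 then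
    let p := Classical.choose h
    some (updateBox t p.1 p.2 ((t p.1 p.2).erase (i + 1)))
  else none

/-- `t'` is the result of applying `g` to `t` as many times as possible. -/
def MaxApply (g : Filling → Option Filling) (t t' : Filling) : Prop :=
  (∃ m, iterOpt g m t = some t') ∧ g t' = none

/-- One Demazure step: apply `e_i` as many times as possible, then `e_i^K` as many times
as possible (here `eKop i` is the `i`-th K-operator). -/
def DemStep (n : ℕ) (lam : ℕ → ℕ) (eKop : ℕ → Filling → Option Filling) (i : ℕ)
    (t t' : Filling) : Prop :=
  ∃ t1, MaxApply (eRaw n lam i) t t1 ∧ MaxApply (eKop i) t1 t'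

/-- `DemReach n lam eKop [i₁,…,iℓ] t u` holds when
`u = (e_{iℓ}^K)^max e_{iℓ}^max ⋯ (e_{i₁}^K)^max e_{i₁}^max t`. -/
def DemReach (n : ℕ) (lam : ℕ → ℕ) (eKop : ℕ → Filling → Option Filling) :
    List ℕ → Filling → Filling → Prop
  | [], t, u => t = u
  | i :: rest, t, u => ∃ t2, DemStep n lam eKop i t t2 ∧ DemReach n lam eKop rest t2 u

/-- The minimal highest weight tableau `u_λ`, whose row `r` boxes are all `{r+1}`. -/
def uTab (lam : ℕ → ℕ) : Filling := fun r c => if c < lam r then {r + 1} else ∅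

/-- The K-Demazure crystal associated with a word `[i₁,…,iℓ]`. -/
def KDem (n : ℕ) (lam : ℕ → ℕ) (eKop : ℕ → Filling → Option Filling) (word : List ℕ) :
    Set Filling :=
  {t | IsSVT n lam t ∧ DemReach n lam eKop word t (uTab lam)}

/-! ### Permutations and reduced words -/

/-- The permutation `s_{i₁} ⋯ s_{iℓ}` of a word `[i₁,…,iℓ]`, where `s_i` swaps `i`, `i+1`. -/
def wordPerm (word : List ℕ) : Equiv.Perm ℕ :=
  (word.map fun i => Equiv.swap i (i + 1)).prod

/-- `word` is a reduced word for `w` in the Coxeter generators `s_1, …, s_{n-1}`. -/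
def IsReducedWord (n : ℕ) (w : Equiv.Perm ℕ) (word : List ℕ) : Prop :=
  (∀ i ∈ word, 1 ≤ i ∧ i < n) ∧ wordPerm word = w ∧
    ∀ word' : List ℕ, (∀ i ∈ word', 1 ≤ i ∧ i < n) → wordPerm word' = w →
      word.length ≤ word'.length

/-- The Coxeter length of a permutation of `{1,…,n}`. -/
def permLength (n : ℕ) (σ : Equiv.Perm ℕ) : ℕ :=
  sInf {l | ∃ word : List ℕ, (∀ i ∈ word, 1 ≤ i ∧ i < n) ∧ wordPerm word = σ ∧
    word.length = l}

/-- The parabolic subgroup generated by `s_2, …, s_{n-1}`. -/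
def parabolic (n : ℕ) : Subgroup (Equiv.Perm ℕ) :=
  Subgroup.closure {σ | ∃ i, 2 ≤ i ∧ i < n ∧ σ = Equiv.swap i (i + 1)}

/-! ### Polynomials -/

/-- Polynomials in `x₁, x₂, …` over `ℤ[β]`; the variable `β` is `Polynomial.X`. -/
abbrev KPoly : Type := MvPolynomial ℕ (Polynomial ℤ)

/-- The scalar `β`. -/
def betaP : KPoly := MvPolynomial.C Polynomial.X

/-- The monomial `x^{wt(T)} = x₁^{wt₁} ⋯ xₙ^{wtₙ}`. -/
def xwt (n : ℕ) (lam : ℕ → ℕ) (t : Filling) : KPoly :=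
  ∏ j ∈ Finset.Icc 1 n, (MvPolynomial.X j : KPoly) ^ wt n lam t j

/-- The β-character `∑_{T ∈ S} β^{excess T} x^{wt T}` of a set of tableaux. -/
def charSet (n : ℕ) (lam : ℕ → ℕ) (S : Set Filling) : KPoly :=
  ∑ᶠ t ∈ S, betaP ^ excess n lam t * xwt n lam t

/-- The symmetric Grothendieck polynomial `𝔊_λ(x₁,…,xₙ; β)`. -/
def Groth (n : ℕ) (lam : ℕ → ℕ) : KPoly :=
  charSet n lam {t | IsSVT n lam t}

/-- The Schur polynomial `s_μ(x₁,…,xₙ)`. -/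
def SchurP (n : ℕ) (mu : ℕ → ℕ) : KPoly :=
  ∑ᶠ t ∈ {t : Filling | IsSSYT n mu t}, xwt n mu t

/-- The numerator defining the Demazure–Lascoux operator `ϖ_i`. -/
def DLnum (i : ℕ) (f : KPoly) : KPoly :=
  (MvPolynomial.X i + betaP * MvPolynomial.X i * MvPolynomial.X (i + 1)) * f -
    (MvPolynomial.X (i + 1) + betaP * MvPolynomial.X i * MvPolynomial.X (i + 1)) *
      (MvPolynomial.rename (Equiv.swap i (i + 1)) f)

/-- `DL` implements the Demazure–Lascoux operators `ϖ_i` for `1 ≤ i < n`: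
`(x_i - x_{i+1}) · ϖ_i f` equals the defining numerator. -/
def IsDLOp (n : ℕ) (DL : ℕ → KPoly → KPoly) : Prop :=
  ∀ i, 1 ≤ i → i < n → ∀ f : KPoly,
    (MvPolynomial.X i - MvPolynomial.X (i + 1)) * DL i f = DLnum i f

/-- `applyDL DL [i₁,…,iℓ] f = ϖ_{i₁} ϖ_{i₂} ⋯ ϖ_{iℓ} f`. -/
def applyDL (DL : ℕ → KPoly → KPoly) : List ℕ → KPoly → KPoly
  | [], f => f
  | i :: rest, f => DL i (applyDL DL rest f)

/-- A flagged increasing tableau of skew shape `μ/λ`: a filling of the boxes of `μ/λ` by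
positive integers, strictly increasing along rows and down columns, whose entries in
(0-indexed) row `r` are at most `r`. -/
def IsFlaggedIncreasing (lam mu : ℕ → ℕ) (F : ℕ → ℕ → ℕ) : Prop :=
  (∀ r c, lam r ≤ c → c < mu r → 1 ≤ F r c ∧ F r c ≤ r) ∧
  (∀ r c, ¬ (lam r ≤ c ∧ c < mu r) → F r c = 0) ∧
  (∀ r c, lam r ≤ c → c + 1 < mu r → F r c < F r (c + 1)) ∧
  (∀ r c, lam r ≤ c → c < mu r → lam (r + 1) ≤ c → c < mu (r + 1) → F r c < F (r + 1) c)

namespace IsSVT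

variable {n : ℕ} {lam : ℕ → ℕ} {t : Filling}

theorem lt_of_mem (h : IsSVT n lam t) {r c a : ℕ} (ha : a ∈ t r c) : c < lam r := by
  by_contra hc
  simp [h.emptyOutside r c hc] at ha

theorem row_lt (hlam : IsPartitionShape n lam) (h : IsSVT n lam t) {r c a : ℕ}
    (ha : a ∈ t r c) : r < n := by
  by_contra hr
  have := h.lt_of_mem ha
  rw [hlam.2 r (by omega)] at this
  omega

theorem col_lt (hlam : IsPartitionShape n lam) (h : IsSVT n lam t) {r r' c a b : ℕ}
    (hr : r < r') (ha : a ∈ t r c) (hb : b ∈ t r' c) : a < b := by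
  induction r', hr using Nat.le_induction generalizing b with
  | base => exact h.colStrict r c a b ha hb
  | succ k hk ih =>
    obtain ⟨x, hx⟩ := h.boxNonempty k c ((h.lt_of_mem hb).trans_le (hlam.1 k))
    exact (ih hx).trans (h.colStrict k c x b hx hb)

theorem row_le (h : IsSVT n lam t) {r c c' a b : ℕ}
    (hc : c < c') (ha : a ∈ t r c) (hb : b ∈ t r c') : a ≤ b := by
  induction c', hc using Nat.le_induction generalizing b with
  | base => exact h.rowWeak r c a b ha hb
  | succ k hk ih =>
    obtain ⟨x, hx⟩ := h.boxNonempty r k (by have := h.lt_of_mem hb; omega)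
    exact (ih hx).trans (h.rowWeak r k x b hx hb)

theorem row_unique (hlam : IsPartitionShape n lam) (h : IsSVT n lam t) {r r' c a : ℕ}
    (ha : a ∈ t r c) (hb : a ∈ t r' c) : r = r' := by
  rcases lt_trichotomy r r' with hr | hr | hr
  · exact absurd (h.col_lt hlam hr ha hb) (lt_irrefl _)
  · exact hr
  · exact absurd (h.col_lt hlam hr hb ha) (lt_irrefl _)

end IsSVT

theorem IsPartitionShape.antitone {n : ℕ} {lam : ℕ → ℕ} (h : IsPartitionShape n lam) :
    Antitone lam := antitone_nat_of_succ_le h.1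

/-- The number of columns in the interval `[c, N)` containing the entry `a`. -/
def colCount (t : Filling) (N a c : ℕ) : ℕ :=
  ((Finset.Ico c N).filter (fun c' => ∃ r, a ∈ t r c')).card

theorem colCount_of_le (t : Filling) {N a c : ℕ} (h : N ≤ c) : colCount t N a c = 0 := by
  simp [colCount, Finset.Ico_eq_empty_of_le h]

theorem colCount_of_lt (t : Filling) {N a c : ℕ} (h : c < N) :
    colCount t N a c = colCount t N a (c + 1) + if ∃ r, a ∈ t r c then 1 else 0 := by
  unfold colCount
  rw [← Finset.insert_Ico_add_one_left_eq_Ico h, Finset.filter_insert]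
  split_ifs
  · rw [Finset.card_insert_of_notMem (by simp)]
  · rfl

theorem colCount_add (t : Filling) {N a c c' : ℕ} (h : c ≤ c') (h' : c' ≤ N) :
    colCount t c' a c + colCount t N a c' = colCount t N a c := by
  unfold colCount
  rw [← Finset.Ico_union_Ico_eq_Ico h h', Finset.filter_union, Finset.card_union_of_disjoint]
  exact Finset.disjoint_filter_filter (Finset.Ico_disjoint_Ico_consecutive c c' N)

theorem wt_eq_colCount {n : ℕ} {lam : ℕ → ℕ} {t : Filling} (hlam : IsPartitionShape n lam)
    (ht : IsSVT n lam t) (a : ℕ) : wt n lam t a = colCount t (lam 0) a 0 := by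
  unfold wt colCount
  refine Finset.card_bij (fun p _ => p.2) ?_ ?_ ?_
  · simp only [Finset.mem_filter, Finset.mem_product, Finset.mem_range, Finset.mem_Ico]
    rintro ⟨r, c⟩ ⟨⟨_, hc⟩, ha⟩
    exact ⟨⟨Nat.zero_le _, hc⟩, r, ha⟩
  · simp only [Finset.mem_filter]
    rintro ⟨r, c⟩ ⟨_, ha⟩ ⟨r', c'⟩ ⟨_, hb⟩ (rfl : c = c')
    have := ht.row_unique hlam ha hb
    simp_all
  · simp only [Finset.mem_filter, Finset.mem_product, Finset.mem_range, Finset.mem_Ico]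
    rintro c ⟨⟨_, hc⟩, r, ha⟩
    exact ⟨(r, c), ⟨⟨ht.row_lt hlam ha, hc⟩, ha⟩, rfl⟩

theorem colHas_iff {n : ℕ} {lam : ℕ → ℕ} {t : Filling} (hlam : IsPartitionShape n lam)
    (ht : IsSVT n lam t) (a c : ℕ) : colHas n t a c ↔ ∃ r, a ∈ t r c :=
  ⟨fun ⟨r, _, h⟩ => ⟨r, h⟩, fun ⟨r, h⟩ => ⟨r, ht.row_lt hlam h, h⟩⟩

theorem eRaw_eq_none_iff (n : ℕ) (lam : ℕ → ℕ) (i : ℕ) (t : Filling) :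
    eRaw n lam i t = none ↔ ∀ c, ¬ MinusCol n (lam 0) t i c := by
  constructor
  · intro h c hc
    have hex : ∃ c, eBoxCol n (lam 0) t i c :=
      ⟨Nat.find ⟨c, hc⟩, Nat.find_spec ⟨c, hc⟩, fun c' h' => Nat.find_min' _ h'⟩
    have hr : ∃ r, r < n ∧ (i + 1) ∈ t r (Classical.choose hex) := by
      have := (Classical.choose_spec hex).1.2.1
      unfold colSign at this
      by_contra hno
      have hno' : ¬ colHas n t (i + 1) (Classical.choose hex) := hno
      simp [hno'] at this
    unfold eRaw at h
    rw [dif_pos hex] at h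
    simp only [dif_pos hr] at h
    split_ifs at h
  · intro h
    unfold eRaw
    rw [dif_neg]
    rintro ⟨c, hc⟩
    exact h c hc.1

theorem pctr_drop_of_lt (n : ℕ) (t : Filling) (i : ℕ) {N c : ℕ} (h : c < N) :
    pctr (((List.range N).drop c).filterMap (colSign n t i)) =
      if colSign n t i c = some true then pctr (colWordAfter n N t i c) + 1
      else if colSign n t i c = some false then pctr (colWordAfter n N t i c) - 1
      else pctr (colWordAfter n N t i c) := by
  rw [List.drop_eq_getElem_cons (by simpa using h), List.getElem_range, List.filterMap_cons]
  rcases colSign n t i c with _ | _ | _ <;> simp [pctr, colWordAfter]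

theorem isYamanouchi_iff {n : ℕ} {lam : ℕ → ℕ} {t : Filling} (hlam : IsPartitionShape n lam)
    (ht : IsSVT n lam t) : IsYamanouchi n lam t ↔ ∀ i, 1 ≤ i → i < n → ∀ c,
      colCount t (lam 0) (i + 1) c ≤ colCount t (lam 0) i c := by
  refine forall_congr' fun i => forall_congr' fun _ => forall_congr' fun _ => ?_
  rw [eRaw_eq_none_iff]
  have key : ∀ c, c < lam 0 → colSign n t i c =
      if (∃ r, i ∈ t r c) ∧ ¬ (∃ r, i + 1 ∈ t r c) then some true
      else if (∃ r, i + 1 ∈ t r c) ∧ ¬ (∃ r, i ∈ t r c) then some false else none := by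
    intro c _
    simp only [colSign, colHas_iff hlam ht]
  constructor
  · intro h
    suffices ∀ c, pctr (((List.range (lam 0)).drop c).filterMap (colSign n t i)) +
        colCount t (lam 0) (i + 1) c = colCount t (lam 0) i c from fun c => by
      have := this c; omega
    intro c
    obtain hc | hc := le_or_gt (lam 0) c
    · rw [colCount_of_le t hc, colCount_of_le t hc, List.drop_eq_nil_of_le (by simpa using hc)]
      simp [pctr]
    · have hc' := hc.le
      induction hc' using Nat.decreasingInduction with
      | self => omega
      | of_succ k hk ih =>
        have ih' : pctr (colWordAfter n (lam 0) t i k) + colCount t (lam 0) (i + 1) (k + 1) =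
            colCount t (lam 0) i (k + 1) := by
          obtain hc' | hc' := le_or_gt (lam 0) (k + 1)
          · rw [colCount_of_le t hc', colCount_of_le t hc', colWordAfter,
              List.drop_eq_nil_of_le (by simpa using hc')]
            simp [pctr]
          · exact ih hc'
        rw [pctr_drop_of_lt n t i hc, colCount_of_lt t hc, colCount_of_lt t hc]
        have hm := h k
        simp only [MinusCol, hc, true_and, not_and] at hm
        have hk' := key k hc
        by_cases h1 : ∃ r, i ∈ t r k <;> by_cases h2 : ∃ r, i + 1 ∈ t r k <;>
          simp only [h1, h2, not_true, not_false_iff, and_true, and_false, if_true, if_false]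
            at hk' ⊢ <;> simp [hk'] at hm ⊢ <;> omega
  · intro h
    have P : ∀ c, c ≤ lam 0 →
        pctr (((List.range (lam 0)).drop c).filterMap (colSign n t i)) +
        colCount t (lam 0) (i + 1) c = colCount t (lam 0) i c := by
      intro c hc
      induction hc using Nat.decreasingInduction with
      | self =>
        rw [colCount_of_le t le_rfl, colCount_of_le t le_rfl, List.drop_eq_nil_of_le (by simp)]
        simp [pctr]
      | of_succ k hk ih =>
        change pctr (colWordAfter n (lam 0) t i k) + _ = _ at ih
        rw [pctr_drop_of_lt n t i hk]
        have hh := h k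
        rw [colCount_of_lt t hk, colCount_of_lt t hk] at hh ⊢
        have hk' := key k hk
        by_cases h1 : ∃ r, i ∈ t r k <;> by_cases h2 : ∃ r, i + 1 ∈ t r k <;>
          simp only [h1, h2, not_true, not_false_iff, and_true, and_false, if_true, if_false]
            at hk' hh ⊢ <;> simp [hk'] <;> omega
    rintro c ⟨hc, hs, hp⟩
    have h1 : pctr (colWordAfter n (lam 0) t i c) + _ = _ := P (c + 1) hc
    have hh := h c
    rw [colCount_of_lt t hc, colCount_of_lt t hc] at hh
    rw [key c hc] at hs
    split_ifs at hs hh <;> first | omega | tauto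

/-- The reflection of the smallest interval containing `S`. -/
def reflectIn (S : Set ℕ) (c : ℕ) : ℕ := sInf S + sSup S - c

theorem reflectIn_spec {S : Set ℕ} (hb : BddAbove S)
    (hS : ∀ a b x, a ∈ S → b ∈ S → a < x → x < b → x ∈ S) {c : ℕ} (hc : c ∈ S) :
    reflectIn S c ∈ S ∧ reflectIn S (reflectIn S c) = c ∧
      reflectIn S c + c = sInf S + sSup S := by
  have h1 : sInf S ≤ c := Nat.sInf_le hc
  have h2 : c ≤ sSup S := le_csSup hb hc
  have h3 : sInf S ∈ S := Nat.sInf_mem ⟨c, hc⟩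
  have h4 : sSup S ∈ S := Nat.sSup_mem ⟨c, hc⟩ hb
  unfold reflectIn
  refine ⟨?_, by omega, by omega⟩
  rcases Nat.lt_or_ge (sInf S) c with h5 | h5
  · rcases Nat.lt_or_ge c (sSup S) with h6 | h6
    · exact hS _ _ _ h3 h4 (by omega) (by omega)
    · rwa [show sInf S + sSup S - c = sInf S by omega]
  · rwa [show sInf S + sSup S - c = sSup S by omega]

/-- The box `(r, c)` is the only one of its column containing `i` or `i + 1`, and lies to the
left of column `C`. -/
def FreeBox (t : Filling) (i C r c : ℕ) : Prop :=
  c < C ∧ (i ∈ t r c ∨ i + 1 ∈ t r c) ∧ ∀ r', r' ≠ r → i ∉ t r' c ∧ i + 1 ∉ t r' c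

/-- The columns of the free boxes of row `r`. -/
def freeCols (t : Filling) (i C r : ℕ) : Set ℕ := {c | FreeBox t i C r c}

/-- The Bender–Knuth involution exchanging the multiplicities of `i` and `i + 1` in the columns
to the left of column `C`. -/
def benderKnuth (i C : ℕ) (t : Filling) : Filling := fun r c =>
  if FreeBox t i C r c then
    (t r c).filter (fun a => a ≠ i ∧ a ≠ i + 1) ∪
      ((if i + 1 ∈ t r (reflectIn (freeCols t i C r) c) then {i} else ∅) ∪
       (if i ∈ t r (reflectIn (freeCols t i C r) c) then {i + 1} else ∅))
  else t r c

theorem benderKnuth_of_not_free {t : Filling} {i C r c : ℕ} (h : ¬ FreeBox t i C r c) :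
    benderKnuth i C t r c = t r c := if_neg h

theorem benderKnuth_of_le (t : Filling) (i : ℕ) {C r c : ℕ} (h : C ≤ c) :
    benderKnuth i C t r c = t r c :=
  benderKnuth_of_not_free fun hf => absurd hf.1 (by omega)

theorem mem_benderKnuth_of_ne {t : Filling} {i C r c a : ℕ} (h1 : a ≠ i) (h2 : a ≠ i + 1) :
    a ∈ benderKnuth i C t r c ↔ a ∈ t r c := by
  unfold benderKnuth
  split_ifs <;> simp [h1, h2]

theorem mem_benderKnuth_left {t : Filling} {i C r c : ℕ} (h : FreeBox t i C r c) :
    i ∈ benderKnuth i C t r c ↔ i + 1 ∈ t r (reflectIn (freeCols t i C r) c) := by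
  unfold benderKnuth
  rw [if_pos h]
  split_ifs <;> simp_all

theorem mem_benderKnuth_right {t : Filling} {i C r c : ℕ} (h : FreeBox t i C r c) :
    i + 1 ∈ benderKnuth i C t r c ↔ i ∈ t r (reflectIn (freeCols t i C r) c) := by
  unfold benderKnuth
  rw [if_pos h]
  split_ifs <;> simp_all

section

variable {n : ℕ} {lam : ℕ → ℕ} {t : Filling} {i C : ℕ}

theorem bddAbove_freeCols (t : Filling) (i C r : ℕ) : BddAbove (freeCols t i C r) :=
  ⟨C, fun _ h => h.1.le⟩

theorem freeCols_interval (hlam : IsPartitionShape n lam) (ht : IsSVT n lam t) (r a b x : ℕ)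
    (ha : a ∈ freeCols t i C r) (hb : b ∈ freeCols t i C r) (hax : a < x) (hxb : x < b) :
    x ∈ freeCols t i C r := by
  obtain ⟨-, ha1, ha2⟩ := ha
  obtain ⟨hbC, hb1, hb2⟩ := hb
  obtain ⟨u, hu, hui⟩ : ∃ u ∈ t r a, i ≤ u := by
    rcases ha1 with h | h
    exacts [⟨_, h, le_rfl⟩, ⟨_, h, by omega⟩]
  obtain ⟨v, hv, hvi⟩ : ∃ v ∈ t r b, v ≤ i + 1 := by
    rcases hb1 with h | h
    exacts [⟨_, h, by omega⟩, ⟨_, h, le_rfl⟩]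
  have hb' := ht.lt_of_mem hv
  obtain ⟨y, hy⟩ := ht.boxNonempty r x (by omega)
  have h1 := ht.row_le hax hu hy
  have h2 := ht.row_le hxb hy hv
  refine ⟨by omega, ?_, fun r' hr' => ?_⟩
  · rcases (by omega : y = i ∨ y = i + 1) with rfl | rfl
    exacts [Or.inl hy, Or.inr hy]
  have main : ∀ z ∈ t r' x, z = i ∨ z = i + 1 → False := by
    intro z hz hzi
    rcases lt_or_gt_of_ne hr' with h | h
    · have h3 := ht.col_lt hlam h hz hy
      obtain ⟨w, hw⟩ := ht.boxNonempty r' b (hb'.trans_le (hlam.antitone h.le))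
      have h4 := ht.row_le hxb hz hw
      have h5 := ht.col_lt hlam h hw hv
      obtain rfl : w = i := by omega
      exact (hb2 r' hr').1 hw
    · have h3 := ht.col_lt hlam h hy hz
      have := ht.lt_of_mem hz
      obtain ⟨w, hw⟩ := ht.boxNonempty r' a (by omega)
      have h4 := ht.row_le hax hw hz
      have h5 := ht.col_lt hlam h hu hw
      obtain rfl : w = i + 1 := by omega
      exact (ha2 r' hr').2 hw
  exact ⟨fun h => main _ h (Or.inl rfl), fun h => main _ h (Or.inr rfl)⟩

theorem reflect_freeCols (hlam : IsPartitionShape n lam) (ht : IsSVT n lam t) {r c : ℕ}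
    (hc : FreeBox t i C r c) : FreeBox t i C r (reflectIn (freeCols t i C r) c) ∧
      reflectIn (freeCols t i C r) (reflectIn (freeCols t i C r) c) = c ∧
      reflectIn (freeCols t i C r) c + c = sInf (freeCols t i C r) + sSup (freeCols t i C r) :=
  reflectIn_spec (bddAbove_freeCols t i C r) (freeCols_interval hlam ht r) hc

theorem mem_or_mem_benderKnuth (hlam : IsPartitionShape n lam) (ht : IsSVT n lam t) (r c : ℕ) :
    (i ∈ benderKnuth i C t r c ∨ i + 1 ∈ benderKnuth i C t r c) ↔
      (i ∈ t r c ∨ i + 1 ∈ t r c) := by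
  by_cases h : FreeBox t i C r c
  · rw [mem_benderKnuth_left h, mem_benderKnuth_right h]
    have := (reflect_freeCols hlam ht h).1.2.1
    have := h.2.1
    tauto
  · rw [benderKnuth_of_not_free h]

theorem freeBox_benderKnuth (hlam : IsPartitionShape n lam) (ht : IsSVT n lam t) (r c : ℕ) :
    FreeBox (benderKnuth i C t) i C r c ↔ FreeBox t i C r c := by
  simp only [FreeBox, ← not_or, mem_or_mem_benderKnuth hlam ht]

theorem benderKnuth_benderKnuth (hlam : IsPartitionShape n lam) (ht : IsSVT n lam t) :
    benderKnuth i C (benderKnuth i C t) = t := by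
  have hfree : ∀ r, freeCols (benderKnuth i C t) i C r = freeCols t i C r := fun r =>
    Set.ext fun c => freeBox_benderKnuth hlam ht r c
  ext r c a
  by_cases h : FreeBox t i C r c
  · have h' := (freeBox_benderKnuth hlam ht r c).2 h
    obtain ⟨h1, h2, -⟩ := reflect_freeCols hlam ht h
    by_cases ha : a = i
    · subst ha
      rw [mem_benderKnuth_left h', hfree, mem_benderKnuth_right h1, h2]
    by_cases ha' : a = i + 1
    · subst ha'
      rw [mem_benderKnuth_right h', hfree, mem_benderKnuth_left h1, h2]
    rw [mem_benderKnuth_of_ne ha ha', mem_benderKnuth_of_ne ha ha']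
  · rw [benderKnuth_of_not_free (mt (freeBox_benderKnuth hlam ht r c).1 h),
      benderKnuth_of_not_free h]

/-- The entry of a box of `benderKnuth i C t` can be traced back to an entry of the same box
of `t`, up to exchanging `i` and `i + 1`. -/
theorem exists_mem_of_mem_benderKnuth (hlam : IsPartitionShape n lam) (ht : IsSVT n lam t)
    {r c a : ℕ} (ha : a ∈ benderKnuth i C t r c) :
    ∃ x ∈ t r c, x = a ∨ (x = i ∨ x = i + 1) ∧ (a = i ∨ a = i + 1) := by
  by_cases h : a = i ∨ a = i + 1
  · have : i ∈ t r c ∨ i + 1 ∈ t r c := (mem_or_mem_benderKnuth (C := C) hlam ht r c).1 (by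
      rcases h with rfl | rfl
      exacts [Or.inl ha, Or.inr ha])
    rcases this with h' | h'
    exacts [⟨_, h', Or.inr ⟨Or.inl rfl, h⟩⟩, ⟨_, h', Or.inr ⟨Or.inr rfl, h⟩⟩]
  · push Not at h
    exact ⟨a, (mem_benderKnuth_of_ne h.1 h.2).1 ha, Or.inl rfl⟩

theorem IsSVT.benderKnuth (hlam : IsPartitionShape n lam) (ht : IsSVT n lam t) (hi : 1 ≤ i)
    (hin : i < n) (hC : ∀ r, i ∉ t r C) : IsSVT n lam (benderKnuth i C t) := by
  refine ⟨fun r c hc => ?_, fun r c hc => ?_, fun r c a ha => ?_, fun r c a b ha hb => ?_,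
    fun r c a b ha hb => ?_⟩
  · obtain ⟨x, hx⟩ := ht.boxNonempty r c hc
    by_cases h : x = i ∨ x = i + 1
    · have : i ∈ t r c ∨ i + 1 ∈ t r c := by
        rcases h with rfl | rfl
        exacts [Or.inl hx, Or.inr hx]
      rcases (mem_or_mem_benderKnuth (C := C) hlam ht r c).2 this with h | h
      exacts [⟨_, h⟩, ⟨_, h⟩]
    · push Not at h
      exact ⟨x, (mem_benderKnuth_of_ne h.1 h.2).2 hx⟩
  · refine Finset.eq_empty_of_forall_notMem fun a ha => ?_
    obtain ⟨x, hx, -⟩ := exists_mem_of_mem_benderKnuth hlam ht ha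
    exact hc (ht.lt_of_mem hx)
  · obtain ⟨x, hx, h⟩ := exists_mem_of_mem_benderKnuth hlam ht ha
    have := ht.entryBounds r c x hx
    omega
  · obtain ⟨x, hx, hxa⟩ := exists_mem_of_mem_benderKnuth hlam ht ha
    obtain ⟨y, hy, hyb⟩ := exists_mem_of_mem_benderKnuth hlam ht hb
    have hxy := ht.rowWeak r c x y hx hy
    by_contra hab
    obtain ⟨rfl, rfl⟩ : a = i + 1 ∧ b = i := by omega
    by_cases h1 : FreeBox t b C r c <;> by_cases h2 : FreeBox t b C r (c + 1)
    · rw [mem_benderKnuth_right h1] at ha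
      rw [mem_benderKnuth_left h2] at hb
      obtain ⟨h3, -, h4⟩ := reflect_freeCols hlam ht h1
      obtain ⟨h5, -, h6⟩ := reflect_freeCols hlam ht h2
      have := ht.row_le (by omega) hb ha
      omega
    · rw [benderKnuth_of_not_free h2] at hb
      have hcC : c + 1 < C := by
        have := h1.1
        by_contra hcC
        obtain rfl : C = c + 1 := by omega
        exact hC r hb
      refine h2 ⟨hcC, Or.inl hb, fun r' hr' => ⟨fun h => hr' (ht.row_unique hlam h hb), fun h => ?_⟩⟩
      have hlt : r < r' := by
        by_contra hlt
        have := ht.col_lt hlam (by omega) h hb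
        omega
      have := ht.lt_of_mem h
      obtain ⟨w, hw⟩ := ht.boxNonempty r' c (by omega)
      have h4 := ht.rowWeak _ _ _ _ hw h
      have h5 := ht.col_lt hlam hlt hx hw
      obtain rfl : w = b + 1 := by omega
      exact (h1.2.2 r' hr').2 hw
    · rw [benderKnuth_of_not_free h1] at ha
      refine h1 ⟨by have := h2.1; omega, Or.inr ha,
        fun r' hr' => ⟨fun h => ?_, fun h => hr' (ht.row_unique hlam h ha)⟩⟩
      have hlt : r' < r := by
        by_contra hlt
        have := ht.col_lt hlam (show r < r' by omega) ha h
        omega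
      have := ht.lt_of_mem hy
      obtain ⟨w, hw⟩ := ht.boxNonempty r' (c + 1) (this.trans_le (hlam.antitone hlt.le))
      have h4 := ht.rowWeak _ _ _ _ h hw
      have h5 := ht.col_lt hlam hlt hw hy
      obtain rfl : w = b := by omega
      exact (h2.2.2 r' hr').1 hw
    · rw [benderKnuth_of_not_free h1] at ha
      rw [benderKnuth_of_not_free h2] at hb
      exact hab (ht.rowWeak r c _ _ ha hb)
  · obtain ⟨x, hx, hxa⟩ := exists_mem_of_mem_benderKnuth hlam ht ha
    obtain ⟨y, hy, hyb⟩ := exists_mem_of_mem_benderKnuth hlam ht hb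
    have hxy := ht.colStrict r c x y hx hy
    by_cases h1 : FreeBox t i C r c
    · have h3 := h1.2.2 (r + 1) (by omega)
      have h4 : y ≠ i := fun h => h3.1 (h ▸ hy)
      have h5 : y ≠ i + 1 := fun h => h3.2 (h ▸ hy)
      omega
    by_cases h2 : FreeBox t i C (r + 1) c
    · have h3 := h2.2.2 r (by omega)
      have h4 : x ≠ i := fun h => h3.1 (h ▸ hx)
      have h5 : x ≠ i + 1 := fun h => h3.2 (h ▸ hx)
      omega
    rw [benderKnuth_of_not_free h1] at ha
    rw [benderKnuth_of_not_free h2] at hb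
    exact ht.colStrict r c _ _ ha hb

theorem colCount_benderKnuth_of_le (t : Filling) (i : ℕ) {C N a c : ℕ} (h : C ≤ c) :
    colCount (benderKnuth i C t) N a c = colCount t N a c := by
  unfold colCount
  congr 1
  refine Finset.filter_congr fun c' hc' => ?_
  simp only [benderKnuth_of_le t i (h.trans (Finset.mem_Ico.1 hc').1)]

theorem colCount_benderKnuth_of_ne (t : Filling) {i C N a c : ℕ} (h1 : a ≠ i) (h2 : a ≠ i + 1) :
    colCount (benderKnuth i C t) N a c = colCount t N a c := by
  simp only [colCount, mem_benderKnuth_of_ne h1 h2]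

/-- The column involution underlying `benderKnuth`. -/
def reflectCol (t : Filling) (i C c : ℕ) : ℕ :=
  if h : ∃ r, FreeBox t i C r c then reflectIn (freeCols t i C h.choose) c else c

theorem FreeBox.row_unique {r r' c : ℕ} (h : FreeBox t i C r c) (h' : FreeBox t i C r' c) :
    r = r' := by
  by_contra hr
  have := h.2.2 r' (Ne.symm hr)
  have := h'.2.1
  tauto

theorem reflectCol_of_free {r c : ℕ} (h : FreeBox t i C r c) :
    reflectCol t i C c = reflectIn (freeCols t i C r) c := by
  have hex : ∃ r, FreeBox t i C r c := ⟨r, h⟩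
  rw [reflectCol, dif_pos hex, hex.choose_spec.row_unique h]

theorem colHas_of_not_free (hlam : IsPartitionShape n lam) (ht : IsSVT n lam t) {c : ℕ}
    (hc : c < C) (h : ¬ ∃ r, FreeBox t i C r c) : (∃ r, i ∈ t r c) ↔ ∃ r, i + 1 ∈ t r c := by
  constructor
  · rintro ⟨r, hr⟩
    by_contra hno
    push Not at hno
    exact h ⟨r, hc, Or.inl hr, fun r' hr' => ⟨fun h' => hr' (ht.row_unique hlam h' hr), hno r'⟩⟩
  · rintro ⟨r, hr⟩
    by_contra hno
    push Not at hno
    exact h ⟨r, hc, Or.inr hr, fun r' hr' => ⟨hno r', fun h' => hr' (ht.row_unique hlam h' hr)⟩⟩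

theorem exists_mem_iff_of_free {r c : ℕ} (h : FreeBox t i C r c) :
    ((∃ r', i ∈ t r' c) ↔ i ∈ t r c) ∧ ((∃ r', i + 1 ∈ t r' c) ↔ i + 1 ∈ t r c) := by
  constructor
  · refine ⟨fun ⟨r', hr'⟩ => ?_, fun h => ⟨r, h⟩⟩
    by_cases h' : r' = r
    exacts [h' ▸ hr', absurd hr' (h.2.2 r' h').1]
  · refine ⟨fun ⟨r', hr'⟩ => ?_, fun h => ⟨r, h⟩⟩
    by_cases h' : r' = r
    exacts [h' ▸ hr', absurd hr' (h.2.2 r' h').2]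

theorem colHas_benderKnuth (hlam : IsPartitionShape n lam) (ht : IsSVT n lam t) {c : ℕ}
    (hc : c < C) :
    ((∃ r, i ∈ benderKnuth i C t r c) ↔ ∃ r, i + 1 ∈ t r (reflectCol t i C c)) ∧
    ((∃ r, i + 1 ∈ benderKnuth i C t r c) ↔ ∃ r, i ∈ t r (reflectCol t i C c)) := by
  by_cases h : ∃ r, FreeBox t i C r c
  · obtain ⟨r, hr⟩ := h
    have h1 := exists_mem_iff_of_free ((freeBox_benderKnuth hlam ht r c).2 hr)
    have h2 := exists_mem_iff_of_free (reflect_freeCols hlam ht hr).1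
    rw [h1.1, h1.2, reflectCol_of_free hr, h2.1, h2.2, mem_benderKnuth_left hr,
      mem_benderKnuth_right hr]
    exact ⟨Iff.rfl, Iff.rfl⟩
  · have h' := colHas_of_not_free hlam ht hc h
    rw [reflectCol, dif_neg h, ← h']
    have : ∀ r, benderKnuth i C t r c = t r c := fun r =>
      benderKnuth_of_not_free fun hf => h ⟨r, hf⟩
    simp only [this, h', and_self]

theorem reflectCol_spec (hlam : IsPartitionShape n lam) (ht : IsSVT n lam t) {c : ℕ}
    (hc : c < C) : reflectCol t i C c < C ∧ reflectCol t i C (reflectCol t i C c) = c := by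
  by_cases h : ∃ r, FreeBox t i C r c
  · obtain ⟨r, hr⟩ := h
    obtain ⟨h1, h2, -⟩ := reflect_freeCols hlam ht hr
    rw [reflectCol_of_free hr, reflectCol_of_free h1]
    exact ⟨h1.1, h2⟩
  · have : reflectCol t i C c = c := by rw [reflectCol, dif_neg h]
    rw [this, this]
    exact ⟨hc, rfl⟩

theorem colCount_benderKnuth (hlam : IsPartitionShape n lam) (ht : IsSVT n lam t) :
    colCount (benderKnuth i C t) C i 0 = colCount t C (i + 1) 0 ∧
    colCount (benderKnuth i C t) C (i + 1) 0 = colCount t C i 0 := by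
  unfold colCount
  constructor <;>
  · refine Finset.card_nbij' (reflectCol t i C) (reflectCol t i C) ?_ ?_ ?_ ?_ <;> intro c hc <;>
      simp only [Finset.coe_filter, Finset.mem_Ico, Set.mem_ofPred_eq] at hc ⊢ <;>
      have h1 := reflectCol_spec (i := i) hlam ht hc.1.2 <;>
      have h2 := colHas_benderKnuth (i := i) hlam ht hc.1.2 <;>
      have h3 := colHas_benderKnuth (i := i) hlam ht h1.1 <;>
      rw [h1.2] at h3 <;> simp_all

end

theorem finite_setOf_supported {X : Type*} {A : Set X} (hA : A.Finite) (x : X) (n N : ℕ) :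
    {f : ℕ → ℕ → X | (∀ r c, f r c ∈ A) ∧ ∀ r c, ¬ (r < n ∧ c < N) → f r c = x}.Finite := by
  have := hA.to_subtype
  refine Set.finite_coe_iff.1 ?_
  refine Finite.of_injective (β := Fin n → Fin N → A)
    (fun f r c => ⟨f.1 r c, f.2.1 r c⟩) fun f g hfg => ?_
  ext r c
  by_cases h : r < n ∧ c < N
  · have := congrFun (congrFun hfg ⟨r, h.1⟩) ⟨c, h.2⟩
    simpa using this
  · rw [f.2.2 r c h, g.2.2 r c h]

theorem finite_isSVT {n : ℕ} {lam : ℕ → ℕ} (hlam : IsPartitionShape n lam) :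
    {t : Filling | IsSVT n lam t}.Finite := by
  refine (finite_setOf_supported (Finset.finite_toSet (Finset.range (n + 1)).powerset)
    (∅ : Finset ℕ) n (lam 0)).subset fun t ht => ⟨fun r c => ?_, fun r c h => ?_⟩
  · simp only [Finset.coe_powerset, Set.mem_preimage, Set.mem_powerset_iff, Finset.coe_subset]
    intro a ha
    have := ht.entryBounds r c a ha
    simp only [Finset.mem_range]
    omega
  · by_contra hne
    obtain ⟨a, ha⟩ := Finset.nonempty_iff_ne_empty.2 hne
    exact h ⟨ht.row_lt hlam ha, (ht.lt_of_mem ha).trans_le (hlam.antitone (Nat.zero_le r))⟩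

/-- The finite set of set-valued tableaux of shape `lam` with entries at most `n`. -/
def svts (n : ℕ) (lam : ℕ → ℕ) : Finset Filling :=
  if h : {t : Filling | IsSVT n lam t}.Finite then h.toFinset else ∅

theorem mem_svts {n : ℕ} {lam : ℕ → ℕ} (hlam : IsPartitionShape n lam) {t : Filling} :
    t ∈ svts n lam ↔ IsSVT n lam t := by
  simp [svts, dif_pos (finite_isSVT hlam)]

/-- The alternating indicator of the orbit of `u` under permutations of coordinates. -/
def altInd {n : ℕ} (u x : Fin n → ℤ) : ℤ :=
  ∑ w : Equiv.Perm (Fin n), (Equiv.Perm.sign w : ℤ) * if x = u ∘ w then 1 else 0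

section altInd

variable {n : ℕ}

theorem altInd_comp_swap (u x : Fin n → ℤ) {a b : Fin n} (hab : a ≠ b) :
    altInd u (x ∘ Equiv.swap a b) = -altInd u x := by
  unfold altInd
  rw [← Equiv.sum_comp (Equiv.mulRight (Equiv.swap a b)), ← Finset.sum_neg_distrib]
  refine Finset.sum_congr rfl fun w _ => ?_
  have : (x ∘ Equiv.swap a b = u ∘ (w * Equiv.swap a b : Equiv.Perm (Fin n))) ↔ x = u ∘ w := by
    rw [Equiv.Perm.coe_mul, ← Function.comp_assoc]
    exact (Equiv.surjective _).injective_comp_right.eq_iff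
  simp only [Equiv.coe_mulRight, this, Equiv.Perm.sign_mul, Equiv.Perm.sign_swap hab]
  split_ifs <;> simp

theorem altInd_eq_zero_of_eq (u x : Fin n → ℤ) {a b : Fin n} (hab : a ≠ b) (h : u a = u b) :
    altInd u x = 0 := by
  have : altInd u x = -altInd u x := by
    unfold altInd
    rw [← Finset.sum_neg_distrib]
    refine (Equiv.sum_comp (Equiv.mulLeft (Equiv.swap a b)) _).symm.trans
      (Finset.sum_congr rfl fun w _ => ?_)
    have hu : u ∘ Equiv.swap a b = u := by
      funext j
      simp only [Function.comp, Equiv.swap_apply_def]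
      split_ifs <;> simp_all
    have : u ∘ (Equiv.swap a b * w : Equiv.Perm (Fin n)) = u ∘ w := by
      rw [Equiv.Perm.coe_mul, ← Function.comp_assoc, hu]
    simp only [Equiv.coe_mulLeft, this, Equiv.Perm.sign_mul, Equiv.Perm.sign_swap hab]
    split_ifs <;> simp
  omega

theorem altInd_of_strictAnti {u x : Fin n → ℤ} (hu : StrictAnti u) (hx : StrictAnti x) :
    altInd u x = if x = u then 1 else 0 := by
  unfold altInd
  rw [Finset.sum_eq_single 1]
  · simp
  · intro w _ hw
    rw [if_neg, mul_zero]
    rintro rfl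
    apply hw
    have : StrictMono w := fun i j hij => hu.lt_iff_gt.1 (hx hij)
    have h := (StrictMono.range_inj this strictMono_id).1 (by simp)
    exact Equiv.ext fun j => congrFun h j
  · simp

/-- The coordinates of `S`, as a `0`-`1` sequence. -/
def indSeq (S : Finset (Fin n)) (k : ℕ) : ℤ := if ∃ h : k < n, (⟨k, h⟩ : Fin n) ∈ S then 1 else 0

theorem indSeq_coe (S : Finset (Fin n)) (j : Fin n) : indSeq S j = if j ∈ S then 1 else 0 := by
  simp [indSeq]

theorem sum_altInd_sub (u x : Fin n → ℤ) :
    ∑ S : Finset (Fin n), altInd (fun j => u j - indSeq S j) x =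
      ∑ S : Finset (Fin n), altInd u (fun j => x j + indSeq S j) := by
  unfold altInd
  rw [Finset.sum_comm, Finset.sum_comm (γ := Finset (Fin n))]
  refine Finset.sum_congr rfl fun w _ => ?_
  rw [← Equiv.sum_comp w.finsetCongr]
  refine Finset.sum_congr rfl fun S _ => ?_
  congr 1
  refine if_congr ?_ rfl rfl
  simp only [funext_iff, Function.comp, indSeq_coe, Equiv.finsetCongr_apply, Finset.mem_map_equiv,
    Equiv.symm_apply_apply, eq_sub_iff_add_eq]

end altInd

/-- The weight of `t` translated by `α` and by the staircase. -/
def content (n : ℕ) (lam : ℕ → ℕ) (α : ℕ → ℤ) (t : Filling) : Fin n → ℤ :=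
  fun j => α j - j + colCount t (lam 0) (j + 1) 0

/-- The entries of every set of final columns of `t`, added to `α`, form a dominant weight. -/
def Dominant (n : ℕ) (lam : ℕ → ℕ) (α : ℕ → ℤ) (t : Filling) : Prop :=
  ∀ j, j + 1 < n → ∀ c,
    α (j + 1) + colCount t (lam 0) (j + 2) c ≤ α j + colCount t (lam 0) (j + 1) c

/-- The number of `α`-dominant set-valued tableaux of shape `lam` and weight `ν - α`. -/
def domCount (n : ℕ) (lam : ℕ → ℕ) (α ν : ℕ → ℤ) : ℕ :=
  ((svts n lam).filter (fun t => Dominant n lam α t ∧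
    ∀ j, j < n → α j + colCount t (lam 0) (j + 1) 0 = ν j)).card

/-- A failure of `α`-dominance for the columns from `c` on. -/
def Bad (n : ℕ) (lam : ℕ → ℕ) (α : ℕ → ℤ) (t : Filling) (c j : ℕ) : Prop :=
  j + 1 < n ∧ α j + colCount t (lam 0) (j + 1) c < α (j + 1) + colCount t (lam 0) (j + 2) c

/-- The rightmost failure of `α`-dominance, with the smallest entry. -/
def FirstBad (n : ℕ) (lam : ℕ → ℕ) (α : ℕ → ℤ) (t : Filling) (p : ℕ × ℕ) : Prop :=
  Bad n lam α t p.1 p.2 ∧ (∀ c, p.1 < c → ∀ j, ¬ Bad n lam α t c j) ∧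
    ∀ j, j < p.2 → ¬ Bad n lam α t p.1 j

/-- The sign-reversing involution: apply `benderKnuth` to the left of the first failure of
dominance. -/
def flipBad (n : ℕ) (lam : ℕ → ℕ) (α : ℕ → ℤ) (t : Filling) : Filling :=
  if h : ∃ p, FirstBad n lam α t p then benderKnuth (h.choose.2 + 1) h.choose.1 t else t

theorem strictAnti_fin_of_succ_lt {n : ℕ} {X : ℕ → ℤ} (h : ∀ j, j + 1 < n → X (j + 1) < X j) :
    StrictAnti (fun j : Fin n => X j) := by
  rintro ⟨a, ha⟩ ⟨b, hb⟩ hab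
  have hab' : a < b := hab
  change X b < X a
  clear hab
  induction b, hab' using Nat.le_induction with
  | base => exact h a hb
  | succ k hk ih => exact (h k hb).trans (ih (by omega))

section

variable {n : ℕ} {lam : ℕ → ℕ} {t : Filling} {α : ℕ → ℤ}

theorem Bad.lt (hα : ∀ j, j + 1 < n → α (j + 1) ≤ α j) {c j : ℕ} (h : Bad n lam α t c j) :
    c < lam 0 := by
  by_contra hc
  obtain ⟨h1, h2⟩ := h
  rw [colCount_of_le t (by omega), colCount_of_le t (by omega)] at h2
  have := hα j h1
  omega

theorem exists_firstBad (hα : ∀ j, j + 1 < n → α (j + 1) ≤ α j)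
    (h : ¬ Dominant n lam α t) : ∃ p, FirstBad n lam α t p := by
  have hex : ∃ c j, Bad n lam α t c j := by
    by_contra hno
    push Not at hno
    refine h fun j hj c => ?_
    have := hno c j
    simp only [Bad, not_and, not_lt] at this
    exact this hj
  have hb : BddAbove {c | ∃ j, Bad n lam α t c j} :=
    ⟨lam 0, fun c ⟨_, hj⟩ => (Bad.lt hα hj).le⟩
  have hs : ∃ j, Bad n lam α t (sSup {c | ∃ j, Bad n lam α t c j}) j := Nat.sSup_mem hex hb
  refine ⟨(_, Nat.find hs), Nat.find_spec hs, fun c hc j hj => ?_, fun j hj => Nat.find_min hs hj⟩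
  have : c ≤ _ := le_csSup hb ⟨j, hj⟩
  exact absurd hc (not_lt.2 this)

theorem FirstBad.unique {p q : ℕ × ℕ} (hp : FirstBad n lam α t p) (hq : FirstBad n lam α t q) :
    p = q := by
  have h1 : p.1 = q.1 := by
    rcases lt_trichotomy p.1 q.1 with h | h | h
    · exact absurd hq.1 (hp.2.1 _ h _)
    · exact h
    · exact absurd hp.1 (hq.2.1 _ h _)
  refine Prod.ext h1 ?_
  rcases lt_trichotomy p.2 q.2 with h | h | h
  · exact absurd hp.1 (h1 ▸ hq.2.2 _ h)
  · exact h
  · exact absurd hq.1 (h1 ▸ hp.2.2 _ h)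

theorem flipBad_eq {p : ℕ × ℕ} (hp : FirstBad n lam α t p) :
    flipBad n lam α t = benderKnuth (p.2 + 1) p.1 t := by
  have hex : ∃ p, FirstBad n lam α t p := ⟨p, hp⟩
  rw [flipBad, dif_pos hex, hex.choose_spec.unique hp]

theorem FirstBad.spec (hα : ∀ j, j + 1 < n → α (j + 1) ≤ α j) {p : ℕ × ℕ}
    (hp : FirstBad n lam α t p) : p.1 < lam 0 ∧ (∀ r, p.2 + 1 ∉ t r p.1) ∧
      α (p.2 + 1) + colCount t (lam 0) (p.2 + 2) p.1 =
        α p.2 + colCount t (lam 0) (p.2 + 1) p.1 + 1 := by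
  have hc := hp.1.lt hα
  obtain ⟨h1, h2⟩ := hp.1
  have h3 := hp.2.1 (p.1 + 1) (by omega) p.2
  simp only [Bad, not_and, not_lt] at h3
  have h3 := h3 h1
  rw [colCount_of_lt t hc, colCount_of_lt t hc] at h2 ⊢
  refine ⟨hc, ?_⟩
  rw [← not_exists]
  by_cases h4 : ∃ r, p.2 + 1 ∈ t r p.1 <;> by_cases h5 : ∃ r, p.2 + 2 ∈ t r p.1 <;>
    simp only [h4, h5, if_true, if_false, not_true, not_false_iff, true_and, false_and] at h2 ⊢ <;>
    push_cast at h2 ⊢ <;> omega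

theorem bad_benderKnuth_iff {i C c j : ℕ} (h : C ≤ c) :
    Bad n lam α (benderKnuth i C t) c j ↔ Bad n lam α t c j := by
  simp only [Bad, colCount_benderKnuth_of_le t i h]

theorem FirstBad.benderKnuth {p : ℕ × ℕ} (hp : FirstBad n lam α t p) (i : ℕ) :
    FirstBad n lam α (benderKnuth i p.1 t) p :=
  ⟨(bad_benderKnuth_iff le_rfl).2 hp.1,
    fun c hc j => (bad_benderKnuth_iff hc.le).not.2 (hp.2.1 c hc j),
    fun j hj => (bad_benderKnuth_iff le_rfl).not.2 (hp.2.2 j hj)⟩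

theorem content_benderKnuth (hlam : IsPartitionShape n lam) (ht : IsSVT n lam t) {j C : ℕ}
    (hj : j + 1 < n) (hC : C ≤ lam 0)
    (h : α (j + 1) + colCount t (lam 0) (j + 2) C =
        α j + colCount t (lam 0) (j + 1) C + 1) :
    content n lam α (benderKnuth (j + 1) C t) =
      content n lam α t ∘ Equiv.swap ⟨j, by omega⟩ ⟨j + 1, hj⟩ := by
  obtain ⟨e1, e2⟩ := colCount_benderKnuth (i := j + 1) (C := C) hlam ht
  have s := fun t a => colCount_add t (a := a) (Nat.zero_le C) hC
  have l := fun a => colCount_benderKnuth_of_le t (j + 1) (N := lam 0) (a := a) (le_refl C)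
  have s1 := s t (j + 1)
  have s2 := s t (j + 2)
  have s3 := s (benderKnuth (j + 1) C t) (j + 1)
  have s4 := s (benderKnuth (j + 1) C t) (j + 2)
  rw [l] at s3 s4
  funext k
  simp only [content, Function.comp]
  by_cases hk : k = ⟨j, by omega⟩
  · subst hk
    rw [Equiv.swap_apply_left]
    push_cast
    simp only [add_assoc, Nat.reduceAdd] at *
    omega
  by_cases hk' : k = ⟨j + 1, hj⟩
  · subst hk'
    rw [Equiv.swap_apply_right]
    push_cast
    simp only [add_assoc, Nat.reduceAdd] at *
    omega
  · rw [Equiv.swap_apply_of_ne_of_ne hk hk', colCount_benderKnuth_of_ne]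
    · intro h; apply hk; ext; simp; omega
    · intro h; apply hk'; ext; simp; omega

theorem ne_of_altInd_ne_zero {u x y : Fin n → ℤ} (h : altInd u y = - altInd u x)
    (hx : altInd u x ≠ 0) : y ≠ x := by
  rintro rfl
  omega

theorem sum_altInd_content (hlam : IsPartitionShape n lam)
    (hα : ∀ j, j + 1 < n → α (j + 1) ≤ α j) {ν : ℕ → ℤ} (hν : ∀ j, j + 1 < n → ν (j + 1) ≤ ν j) :
    ∑ t ∈ svts n lam, altInd (fun j : Fin n => ν j - j) (content n lam α t) =
      domCount n lam α ν := by
  rw [← Finset.sum_filter_add_sum_filter_not (svts n lam) (Dominant n lam α)]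
  have h0 : ∑ t ∈ (svts n lam).filter (fun t => ¬ Dominant n lam α t),
      altInd (fun j : Fin n => ν j - j) (content n lam α t) = 0 := by
    have key : ∀ t ∈ (svts n lam).filter (fun t => ¬ Dominant n lam α t),
        altInd (fun j : Fin n => ν j - j) (content n lam α (flipBad n lam α t)) =
          - altInd (fun j : Fin n => ν j - j) (content n lam α t) ∧
        flipBad n lam α t ∈ (svts n lam).filter (fun t => ¬ Dominant n lam α t) ∧
        flipBad n lam α (flipBad n lam α t) = t := by
      intro t ht
      rw [Finset.mem_filter, mem_svts hlam] at ht
      obtain ⟨ht, hd⟩ := ht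
      obtain ⟨p, hp⟩ := exists_firstBad hα hd
      obtain ⟨h1, h2, h3⟩ := hp.spec hα
      have hp' := hp.benderKnuth (p.2 + 1)
      rw [flipBad_eq hp, flipBad_eq hp', content_benderKnuth hlam ht hp.1.1 h1.le h3,
        altInd_comp_swap _ _ (by simp), Finset.mem_filter, mem_svts hlam,
        benderKnuth_benderKnuth hlam ht]
      refine ⟨rfl, ⟨ht.benderKnuth hlam (by omega) hp.1.1 h2, fun hd' => ?_⟩, rfl⟩
      have := hd' p.2 hp'.1.1 p.1
      exact absurd hp'.1.2 (not_lt.2 this)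
    refine Finset.sum_involution (fun t _ => flipBad n lam α t) (fun t ht => ?_)
      (fun t ht hne heq => ?_) (fun t ht => (key t ht).2.1) (fun t ht => (key t ht).2.2)
    · rw [(key t ht).1]; ring
    · exact ne_of_altInd_ne_zero (key t ht).1 hne (by rw [heq])
  rw [h0, add_zero, domCount, ← Finset.filter_filter, Finset.card_filter]
  push_cast
  refine Finset.sum_congr rfl fun t ht => ?_
  have hd := (Finset.mem_filter.1 ht).2
  rw [altInd_of_strictAnti]
  · refine if_congr ?_ rfl rfl
    simp only [content, funext_iff, Fin.forall_iff]
    refine forall_congr' fun j => forall_congr' fun _ => ?_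
    constructor <;> intro h <;> linarith
  · refine strictAnti_fin_of_succ_lt (X := fun j => ν j - j) fun j hj => ?_
    have := hν j hj
    push_cast
    omega
  · refine strictAnti_fin_of_succ_lt
      (X := fun j => α j - j + colCount t (lam 0) (j + 1) 0) fun j hj => ?_
    have := hd j hj 0
    push_cast
    simp only [add_assoc, Nat.reduceAdd] at *
    omega

theorem sum_altInd_content_eq_zero (hlam : IsPartitionShape n lam) (u : Fin n → ℤ) {j : ℕ}
    (hj : j + 1 < n) (h : α (j + 1) = α j + 1) :
    ∑ t ∈ svts n lam, altInd u (content n lam α t) = 0 := by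
  have key : ∀ t ∈ svts n lam,
      altInd u (content n lam α (benderKnuth (j + 1) (lam 0) t)) =
        - altInd u (content n lam α t) ∧
      benderKnuth (j + 1) (lam 0) t ∈ svts n lam ∧
      benderKnuth (j + 1) (lam 0) (benderKnuth (j + 1) (lam 0) t) = t := by
    intro t ht
    rw [mem_svts hlam] at ht
    have h0 : ∀ r, j + 1 ∉ t r (lam 0) := fun r hr => by
      have := ht.lt_of_mem hr
      have := hlam.antitone (Nat.zero_le r)
      omega
    rw [mem_svts hlam, content_benderKnuth hlam ht hj le_rfl, altInd_comp_swap _ _ (by simp),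
      benderKnuth_benderKnuth hlam ht]
    · exact ⟨rfl, ht.benderKnuth hlam (by omega) hj h0, rfl⟩
    · rw [colCount_of_le t le_rfl, colCount_of_le t le_rfl, h]
      simp
  refine Finset.sum_involution (fun t _ => benderKnuth (j + 1) (lam 0) t) (fun t ht => ?_)
    (fun t ht hne heq => ?_) (fun t ht => (key t ht).2.1) (fun t ht => (key t ht).2.2)
  · rw [(key t ht).1]; ring
  · exact ne_of_altInd_ne_zero (key t ht).1 hne (by rw [heq])

/-- The sequence `(1, …, 1, 0, …)` with `m` ones. -/
def oneSeq (m : ℕ) (k : ℕ) : ℤ := if k < m then 1 else 0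

/-- The first `n` terms of `ν` form a partition. -/
def IsDominantSeq (n : ℕ) (ν : ℕ → ℤ) : Prop :=
  (∀ j, j + 1 < n → ν (j + 1) ≤ ν j) ∧ ∀ j, j < n → 0 ≤ ν j

theorem sum_indSeq_eq_sum_oneSeq (f : (ℕ → ℤ) → ℤ)
    (hf : ∀ S : Finset (Fin n), (∃ j, j + 1 < n ∧ indSeq S (j + 1) = indSeq S j + 1) →
      f (indSeq S) = 0) :
    ∑ S : Finset (Fin n), f (indSeq S) = ∑ m ∈ Finset.range (n + 1), f (oneSeq m) := by
  let seg : ℕ → Finset (Fin n) := fun m => Finset.univ.filter (fun j => (j : ℕ) < m)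
  have hseg : ∀ m ∈ Finset.range (n + 1), indSeq (seg m) = oneSeq m := by
    intro m hm
    rw [Finset.mem_range] at hm
    funext k
    simp only [indSeq, oneSeq, seg, Finset.mem_filter, Finset.mem_univ, true_and, exists_prop]
    exact if_congr (by omega) rfl rfl
  rw [← Finset.sum_subset (Finset.subset_univ ((Finset.range (n + 1)).image seg)),
    Finset.sum_image]
  · exact Finset.sum_congr rfl fun m hm => by rw [hseg m hm]
  · intro m hm m' hm' h
    have h1 := hseg m hm
    rw [h, hseg m' hm'] at h1
    rcases lt_trichotomy m m' with h2 | h2 | h2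
    · have := congrFun h1 m; simp [oneSeq, h2] at this
    · exact h2
    · have := congrFun h1 m'; simp [oneSeq, h2] at this
  · intro S _ hS
    apply hf
    by_contra hno
    push Not at hno
    apply hS
    have hmono : ∀ j, j + 1 < n → indSeq S (j + 1) = 1 → indSeq S j = 1 := by
      intro j hj h1
      have := hno j hj
      unfold indSeq at *
      split_ifs at * <;> simp_all
    have hS0 : indSeq S n = 0 := by simp [indSeq]
    have hex : ∃ k, indSeq S k = 0 := ⟨n, hS0⟩
    have hle : Nat.find hex ≤ n := Nat.find_min' hex hS0
    refine Finset.mem_image.2 ⟨Nat.find hex, Finset.mem_range.2 (by omega), ?_⟩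
    ext k
    simp only [seg, Finset.mem_filter, Finset.mem_univ, true_and]
    have hk := indSeq_coe S k
    constructor
    · intro h
      have := Nat.find_min hex h
      by_contra hkS
      rw [if_neg hkS] at hk
      exact this hk
    · intro hkS
      rw [if_pos hkS] at hk
      by_contra hlt
      push Not at hlt
      have hback : ∀ l, Nat.find hex ≤ l → l < n → indSeq S l = 1 →
          indSeq S (Nat.find hex) = 1 := by
        intro l hl
        induction l, hl using Nat.le_induction with
        | base => exact fun _ h => h
        | succ l hl ih => exact fun h1 h2 => ih (by omega) (hmono l h1 h2)
      have h1 := hback k hlt k.2 hk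
      have h2 := Nat.find_spec hex
      omega

/-- A Pieri rule for dominant set-valued tableaux. -/
theorem sum_domCount_oneSeq (hlam : IsPartitionShape n lam) {ν : ℕ → ℤ}
    (hν : IsDominantSeq n ν) :
    ∑ m ∈ Finset.range (n + 1), domCount n lam (oneSeq m) ν =
      ∑ S : Finset (Fin n) with IsDominantSeq n (fun k => ν k - indSeq S k),
        domCount n lam 0 (fun k => ν k - indSeq S k) := by
  zify
  have h1 : ∀ m ∈ Finset.range (n + 1), (domCount n lam (oneSeq m) ν : ℤ) =
      ∑ t ∈ svts n lam, altInd (fun j : Fin n => ν j - j) (content n lam (oneSeq m) t) := by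
    intro m _
    refine (sum_altInd_content hlam (fun j _ => ?_) hν.1).symm
    unfold oneSeq
    split_ifs <;> omega
  rw [Finset.sum_congr rfl h1, ← sum_indSeq_eq_sum_oneSeq (fun α => ∑ t ∈ svts n lam,
    altInd (fun j : Fin n => ν j - j) (content n lam α t))
    (fun S ⟨j, hj, h⟩ => sum_altInd_content_eq_zero hlam _ hj h), Finset.sum_filter]
  have h2 : ∀ S : Finset (Fin n), (if IsDominantSeq n (fun k => ν k - indSeq S k) then
      (domCount n lam 0 (fun k => ν k - indSeq S k) : ℤ) else 0) =
      ∑ t ∈ svts n lam, altInd (fun j : Fin n => (ν j - j) - indSeq S j) (content n lam 0 t) := by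
    intro S
    have hc : (fun j : Fin n => (ν j - j) - indSeq S j) =
        fun j : Fin n => (fun k => ν k - indSeq S k) (j : ℕ) - (j : ℤ) := by
      funext j; ring
    rw [hc]
    split_ifs with h
    · exact (sum_altInd_content hlam (fun _ _ => le_rfl) h.1).symm
    · symm
      refine Finset.sum_eq_zero fun t _ => ?_
      by_cases hanti : ∀ j, j + 1 < n → ν (j + 1) - indSeq S (j + 1) ≤ ν j - indSeq S j
      · have hneg : ∃ j, j < n ∧ ν j - indSeq S j < 0 := by
          by_contra hno
          push Not at hno
          exact h ⟨hanti, hno⟩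
        obtain ⟨j, hj, hneg⟩ := hneg
        have hlast : ∀ k, j ≤ k → k < n → ν k - indSeq S k < 0 := by
          intro k hk
          induction k, hk using Nat.le_induction with
          | base => exact fun _ => hneg
          | succ k hk ih => exact fun h1 => (hanti k h1).trans_lt (ih (by omega))
        have hl := hlast (n - 1) (by omega) (by omega)
        refine Finset.sum_eq_zero fun w _ => ?_
        rw [if_neg, mul_zero]
        intro heq
        have := congrFun heq (w.symm ⟨n - 1, by omega⟩)
        have hlt := (w.symm ⟨n - 1, by omega⟩).2
        simp only [content, Function.comp, Equiv.apply_symm_apply, Pi.zero_apply] at this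
        omega
      · push Not at hanti
        obtain ⟨j, hj, hlt⟩ := hanti
        refine altInd_eq_zero_of_eq _ _ (a := ⟨j, by omega⟩) (b := ⟨j + 1, hj⟩) (by simp) ?_
        have := hν.1 j hj
        simp only [indSeq] at hlt ⊢
        push_cast
        split_ifs at hlt ⊢ <;> omega
  rw [Finset.sum_congr rfl fun S _ => h2 S]
  have h3 : ∀ t, ∑ S : Finset (Fin n),
      altInd (fun j : Fin n => ν j - j) (content n lam (indSeq S) t) =
      ∑ S : Finset (Fin n),
        altInd (fun j : Fin n => (ν j - j) - indSeq S j) (content n lam 0 t) := by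
    intro t
    rw [sum_altInd_sub]
    refine Finset.sum_congr rfl fun S _ => ?_
    congr 1
    funext j
    simp only [content, Pi.zero_apply]
    ring
  rw [Finset.sum_comm, Finset.sum_congr rfl fun t _ => h3 t, Finset.sum_comm]

end

section FirstRow

variable {n : ℕ} {lam : ℕ → ℕ} {t : Filling}

theorem IsPartitionShape.tail (h : IsPartitionShape (n + 1) lam) :
    IsPartitionShape n (fun r => lam (r + 1)) :=
  ⟨fun r => h.1 (r + 1), fun r hr => h.2 (r + 1) (by omega)⟩

/-- Add a top row of length `L` to `t` whose boxes are `{1}, …, {1}, {1, …, m + 1}`, raising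
all the entries of `t` by one. -/
def consRow (m L : ℕ) (t : Filling) : Filling
  | 0, c => if c + 1 < L then {1} else if c + 1 = L then Finset.Icc 1 (m + 1) else ∅
  | r + 1, c => (t r c).image (· + 1)

theorem mem_consRow_zero {m L c a : ℕ} :
    a ∈ consRow m L t 0 c ↔ c < L ∧ 1 ≤ a ∧ (a = 1 ∨ c + 1 = L ∧ a ≤ m + 1) := by
  rw [consRow]
  split_ifs <;> simp <;> omega

theorem mem_consRow_succ {m L r c a : ℕ} :
    a ∈ consRow m L t (r + 1) c ↔ 1 ≤ a ∧ a - 1 ∈ t r c := by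
  simp only [consRow, Finset.mem_image]
  constructor
  · rintro ⟨b, hb, rfl⟩
    exact ⟨by omega, by simpa using hb⟩
  · rintro ⟨h1, h2⟩
    exact ⟨a - 1, h2, by omega⟩

theorem isSVT_consRow_iff (hlam : IsPartitionShape (n + 1) lam) {m : ℕ} (hm : m ≤ n) :
    IsSVT (n + 1) lam (consRow m (lam 0) t) ↔
      IsSVT n (fun r => lam (r + 1)) t ∧ ∀ c b, c + 1 = lam 0 → b ∈ t 0 c → m < b := by
  constructor
  · intro h
    have pos : ∀ r c a, a ∈ t r c → 1 ≤ a := by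
      intro r c a ha
      have ha' : a + 1 ∈ consRow m (lam 0) t (r + 1) c := mem_consRow_succ.2 ⟨by omega, by simpa⟩
      obtain ⟨x, hx⟩ := h.boxNonempty r c ((h.lt_of_mem ha').trans_le (hlam.1 r))
      have h1 := h.colStrict r c x _ hx ha'
      have h2 := (h.entryBounds r c x hx).1
      omega
    have up : ∀ {r c a}, a ∈ t r c → a + 1 ∈ consRow m (lam 0) t (r + 1) c :=
      fun ha => mem_consRow_succ.2 ⟨by omega, by simpa⟩
    refine ⟨⟨fun r c hc => ?_, fun r c hc => ?_, fun r c a ha => ?_, fun r c a b ha hb => ?_,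
      fun r c a b ha hb => ?_⟩, fun c b hc hb => ?_⟩
    · obtain ⟨x, hx⟩ := h.boxNonempty (r + 1) c hc
      exact ⟨_, (mem_consRow_succ.1 hx).2⟩
    · by_contra hne
      obtain ⟨x, hx⟩ := Finset.nonempty_iff_ne_empty.2 hne
      exact hc (h.lt_of_mem (up hx))
    · have := h.entryBounds _ _ _ (up ha)
      exact ⟨pos r c a ha, by omega⟩
    · have := h.rowWeak _ _ _ _ (up ha) (up hb)
      omega
    · have := h.colStrict _ _ _ _ (up ha) (up hb)
      omega
    · have := h.colStrict 0 c (m + 1) _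
        (mem_consRow_zero.2 ⟨by omega, by omega, .inr ⟨hc, le_rfl⟩⟩) (up hb)
      omega
  · rintro ⟨h, hcol⟩
    refine ⟨fun r c hc => ?_, fun r c hc => ?_, fun r c a ha => ?_, fun r c a b ha hb => ?_,
      fun r c a b ha hb => ?_⟩
    · cases r with
      | zero => exact ⟨1, mem_consRow_zero.2 ⟨hc, le_rfl, .inl rfl⟩⟩
      | succ r =>
        obtain ⟨x, hx⟩ := h.boxNonempty r c hc
        exact ⟨x + 1, mem_consRow_succ.2 ⟨by omega, by simpa⟩⟩
    · by_contra hne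
      obtain ⟨x, hx⟩ := Finset.nonempty_iff_ne_empty.2 hne
      cases r with
      | zero => exact hc (mem_consRow_zero.1 hx).1
      | succ r => exact hc (h.lt_of_mem (mem_consRow_succ.1 hx).2)
    · cases r with
      | zero =>
        have := mem_consRow_zero.1 ha
        omega
      | succ r =>
        have := mem_consRow_succ.1 ha
        have := h.entryBounds _ _ _ this.2
        omega
    · cases r with
      | zero =>
        have h1 := mem_consRow_zero.1 ha
        have h2 := mem_consRow_zero.1 hb
        omega
      | succ r =>
        have h1 := mem_consRow_succ.1 ha
        have h2 := mem_consRow_succ.1 hb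
        have := h.rowWeak _ _ _ _ h1.2 h2.2
        omega
    · have h2 := mem_consRow_succ.1 hb
      have hb1 := h.entryBounds _ _ _ h2.2
      cases r with
      | zero =>
        have h1 := mem_consRow_zero.1 ha
        have := hcol c (b - 1)
        simp only [h2.2, forall_const] at this
        omega
      | succ r =>
        have h1 := mem_consRow_succ.1 ha
        have := h.colStrict _ _ _ _ h1.2 h2.2
        omega

theorem IsSVT.colCount_eq (hlam : IsPartitionShape n lam) (ht : IsSVT n lam t) {N : ℕ}
    (hN : lam 0 ≤ N) (a c : ℕ) : colCount t N a c = colCount t (lam 0) a c := by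
  unfold colCount
  congr 1
  ext c'
  simp only [Finset.mem_filter, Finset.mem_Ico]
  constructor
  · rintro ⟨h1, r, hr⟩
    exact ⟨⟨h1.1, (ht.lt_of_mem hr).trans_le (hlam.antitone (Nat.zero_le r))⟩, r, hr⟩
  · rintro ⟨h1, h2⟩
    exact ⟨⟨h1.1, by omega⟩, h2⟩

theorem colCount_consRow_one (m L c : ℕ) (t : Filling) :
    colCount (consRow m L t) L 1 c = L - c := by
  rw [colCount, Finset.filter_true_of_mem, Nat.card_Ico]
  intro c' hc'
  exact ⟨0, mem_consRow_zero.2 ⟨(Finset.mem_Ico.1 hc').2, le_rfl, .inl rfl⟩⟩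

theorem colCount_consRow (hlam : IsPartitionShape (n + 1) lam) {m : ℕ}
    (h : IsSVT (n + 1) lam (consRow m (lam 0) t)) (hm : m ≤ n) (j c : ℕ) :
    colCount (consRow m (lam 0) t) (lam 0) (j + 2) c =
      colCount t (lam 1) (j + 1) c + if j < m ∧ c < lam 0 then 1 else 0 := by
  have ht := ((isSVT_consRow_iff hlam hm).1 h).1
  have hN := ht.colCount_eq hlam.tail (hlam.1 0) (j + 1) c
  rw [← hN]
  obtain hc | hc := le_or_gt (lam 0) c
  · rw [colCount_of_le _ hc, colCount_of_le _ hc, if_neg (by omega)]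
  have key : ∀ c', (∃ r, j + 2 ∈ consRow m (lam 0) t r c') ↔
      (c' + 1 = lam 0 ∧ j < m) ∨ ∃ r, j + 1 ∈ t r c' := by
    intro c'
    constructor
    · rintro ⟨_ | r, hr⟩
      · have := mem_consRow_zero.1 hr
        left; omega
      · exact .inr ⟨r, (mem_consRow_succ.1 hr).2⟩
    · rintro (h1 | ⟨r, hr⟩)
      · exact ⟨0, mem_consRow_zero.2 (by omega)⟩
      · exact ⟨r + 1, mem_consRow_succ.2 ⟨by omega, hr⟩⟩
  simp only [colCount, key, Finset.filter_or]
  rw [Finset.card_union_of_disjoint, add_comm]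
  · congr 1
    split_ifs with h1
    · rw [Finset.card_eq_one]
      refine ⟨lam 0 - 1, ?_⟩
      ext c'
      simp only [Finset.mem_filter, Finset.mem_Ico, Finset.mem_singleton]
      omega
    · rw [Finset.card_eq_zero, Finset.filter_eq_empty_iff]
      intro c' _
      omega
  · rw [Finset.disjoint_filter]
    rintro c' _ h1 ⟨r, hr⟩
    have := h.row_unique hlam (a := j + 2) (r := 0) (r' := r + 1) (c := c')
      (mem_consRow_zero.2 (by omega)) (mem_consRow_succ.2 ⟨by omega, hr⟩)
    omega

theorem dominant_consRow_iff (hlam : IsPartitionShape (n + 1) lam) {m : ℕ}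
    (h : IsSVT (n + 1) lam (consRow m (lam 0) t)) (hm : m ≤ n) :
    Dominant (n + 1) lam 0 (consRow m (lam 0) t) ↔
      Dominant n (fun r => lam (r + 1)) (oneSeq m) t := by
  have ht := ((isSVT_consRow_iff hlam hm).1 h).1
  simp only [Dominant, Pi.zero_apply, zero_add]
  constructor
  · intro H j hj c
    obtain hc | hc := le_or_gt (lam 0) c
    · have : lam 1 ≤ c := (hlam.1 0).trans hc
      rw [colCount_of_le t this, colCount_of_le t this]
      simp only [oneSeq]
      split_ifs <;> omega
    · have := H (j + 1) (by omega) c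
      rw [colCount_consRow hlam h hm, colCount_consRow hlam h hm] at this
      simp only [hc, and_true] at this
      simp only [oneSeq]
      push_cast at this
      simp only [add_assoc, Nat.reduceAdd] at *
      linarith
  · intro H j hj c
    obtain hc | hc := le_or_gt (lam 0) c
    · rw [colCount_of_le _ hc, colCount_of_le _ hc]
    · cases j with
      | zero =>
        have : colCount (consRow m (lam 0) t) (lam 0) 2 c ≤ _ := Finset.card_filter_le _ _
        rw [Nat.card_Ico] at this
        rw [zero_add, zero_add, colCount_consRow_one]
        exact_mod_cast this
      | succ j =>
        have := H j (by omega) c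
        rw [colCount_consRow hlam h hm, colCount_consRow hlam h hm]
        simp only [hc, and_true]
        simp only [oneSeq] at this
        push_cast
        simp only [add_assoc, Nat.reduceAdd] at *
        linarith

theorem content_consRow_iff (hlam : IsPartitionShape (n + 1) lam) {m : ℕ} {ν : ℕ → ℤ}
    (h : IsSVT (n + 1) lam (consRow m (lam 0) t)) (hm : m ≤ n) (h0 : lam 0 = 0 → m = 0) :
    (∀ j, j < n + 1 → (0 : ℕ → ℤ) j + colCount (consRow m (lam 0) t) (lam 0) (j + 1) 0 = ν j) ↔
      lam 0 = ν 0 ∧ ∀ j, j < n → oneSeq m j + colCount t (lam 1) (j + 1) 0 = ν (j + 1) := by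
  have key : ∀ j, ((0 : ℕ → ℤ) (j + 1) +
      colCount (consRow m (lam 0) t) (lam 0) (j + 1 + 1) 0 = ν (j + 1)) ↔
      oneSeq m j + colCount t (lam 1) (j + 1) 0 = ν (j + 1) := by
    intro j
    rw [colCount_consRow hlam h hm]
    have : (if j < m ∧ 0 < lam 0 then (1 : ℤ) else 0) = oneSeq m j := by
      unfold oneSeq
      exact if_congr (by omega) rfl rfl
    push_cast
    rw [this, Pi.zero_apply, zero_add, add_comm]
  constructor
  · intro H
    refine ⟨?_, fun j hj => (key j).1 (H (j + 1) (by omega))⟩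
    have := H 0 (by omega)
    rw [zero_add, colCount_consRow_one] at this
    simpa using this
  · rintro ⟨H0, H⟩ (_ | j) hj
    · rw [zero_add, colCount_consRow_one]
      simpa using H0
    · exact (key j).2 (H j (by omega))

/-- In the last column, the first box of a dominant tableau is closed under decreasing an
entry. -/
theorem Dominant.mem_of_succ_mem {α : ℕ → ℤ} (hlam : IsPartitionShape n lam)
    (ht : IsSVT n lam t) (hd : Dominant n lam α t) {c j : ℕ} (hc : lam 0 = c + 1)
    (hj : j + 1 < n) (hα : α j ≤ α (j + 1)) (h : j + 2 ∈ t 0 c) : j + 1 ∈ t 0 c := by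
  have := hd j hj c
  rw [hc, colCount_of_lt t c.lt_succ_self, colCount_of_lt t c.lt_succ_self,
    colCount_of_le t le_rfl, colCount_of_le t le_rfl, if_pos ⟨0, h⟩] at this
  have hex : ∃ r, j + 1 ∈ t r c := by
    by_contra hno
    rw [if_neg hno] at this
    push_cast at this
    omega
  obtain ⟨r, hr⟩ := hex
  rcases Nat.eq_zero_or_pos r with rfl | hr0
  · exact hr
  · have := ht.col_lt hlam hr0 h hr
    omega

theorem isSVT_consRow_of_dominant (hlam : IsPartitionShape (n + 1) lam) {m : ℕ} (hm : m ≤ n)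
    (ht : IsSVT n (fun r => lam (r + 1)) t)
    (hd : Dominant n (fun r => lam (r + 1)) (oneSeq m) t)
    (h1 : 1 ≤ m → colCount t (lam 1) 1 0 < lam 0) :
    IsSVT (n + 1) lam (consRow m (lam 0) t) := by
  refine (isSVT_consRow_iff hlam hm).2 ⟨ht, fun c b hc hb => ?_⟩
  by_contra hbm
  have hcl : c < lam 1 := ht.lt_of_mem hb
  have hle : lam 1 ≤ lam 0 := hlam.1 0
  have hb1 := (ht.entryBounds 0 c b hb).1
  have key : ∀ k, k + 1 ≤ m → k + 1 ∈ t 0 c → 1 ∈ t 0 c := by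
    intro k
    induction k with
    | zero => exact fun _ h => h
    | succ k ih =>
      intro hk h
      refine ih (by omega) (hd.mem_of_succ_mem hlam.tail ht (c := c) ?_ ?_ ?_ h)
      · change lam 1 = c + 1
        omega
      · omega
      · simp only [oneSeq]
        rw [if_pos (by omega), if_pos (by omega)]
  have hmem := key (b - 1) (by omega) (by rwa [Nat.sub_add_cancel hb1])
  have h2 := h1 (by omega)
  rw [colCount, Finset.filter_true_of_mem, Nat.card_Ico] at h2
  · omega
  · intro c' hc'
    rw [Finset.mem_Ico] at hc'
    rcases (show c' ≤ c by omega).eq_or_lt with rfl | hlt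
    · exact ⟨0, hmem⟩
    · obtain ⟨x, hx⟩ := ht.boxNonempty 0 c' hc'.2
      have h3 := ht.row_le hlt hx hmem
      have h4 := (ht.entryBounds _ _ _ hx).1
      obtain rfl : x = 1 := by omega
      exact ⟨0, hx⟩

theorem exists_eq_consRow (hlam : IsPartitionShape (n + 1) lam) (ht : IsSVT (n + 1) lam t)
    (hd : Dominant (n + 1) lam 0 t) :
    ∃ m t', m ≤ n ∧ (lam 0 = 0 → m = 0) ∧ t = consRow m (lam 0) t' := by
  have tail : ∀ m r, t (r + 1) =
      consRow m (lam 0) (fun r c => (t (r + 1) c).image (· - 1)) (r + 1) := by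
    intro m r
    funext c
    ext a
    simp only [mem_consRow_succ, Finset.mem_image]
    constructor
    · exact fun h => ⟨(ht.entryBounds _ _ _ h).1, a, h, rfl⟩
    · rintro ⟨h1, b, hb, h2⟩
      have := (ht.entryBounds _ _ _ hb).1
      obtain rfl : a = b := by omega
      exact hb
  rcases Nat.eq_zero_or_pos (lam 0) with h0 | h0
  · refine ⟨0, fun r c => (t (r + 1) c).image (· - 1), Nat.zero_le _, fun _ => rfl, ?_⟩
    funext r
    cases r with
    | zero =>
      funext c
      rw [ht.emptyOutside 0 c (by omega)]
      simp [consRow, h0]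
    | succ r => exact tail 0 r
  · obtain ⟨c, hc⟩ : ∃ c, lam 0 = c + 1 := ⟨lam 0 - 1, by omega⟩
    have hne := ht.boxNonempty 0 c (by omega)
    have step : ∀ j, j + 2 ∈ t 0 c → j + 1 ∈ t 0 c := fun j hj =>
      hd.mem_of_succ_mem hlam ht hc (by have := (ht.entryBounds _ _ _ hj).2; omega) le_rfl hj
    have down : ∀ d j, j + d + 1 ∈ t 0 c → j + 1 ∈ t 0 c := by
      intro d
      induction d with
      | zero => exact fun _ h => h
      | succ d ih => exact fun j h => ih j (step _ h)
    have hmax := (t 0 c).max'_mem hne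
    have hmb := ht.entryBounds _ _ _ hmax
    set M := (t 0 c).max' hne with hM
    have h1 : 1 ∈ t 0 c := down (M - 1) 0 (by rwa [zero_add, Nat.sub_add_cancel hmb.1])
    refine ⟨M - 1, fun r c => (t (r + 1) c).image (· - 1), by omega, by omega, ?_⟩
    funext r
    cases r with
    | zero =>
      funext c'
      ext a
      rw [mem_consRow_zero]
      constructor
      · intro ha
        have hlt := ht.lt_of_mem ha
        have hpos := (ht.entryBounds _ _ _ ha).1
        refine ⟨hlt, hpos, ?_⟩
        rcases (show c' ≤ c by omega).eq_or_lt with rfl | hlt'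
        · have := (t 0 c').le_max' a ha
          right; omega
        · have := ht.row_le hlt' ha h1
          left; omega
      · rintro ⟨hlt, hpos, h⟩
        rcases (show c' ≤ c by omega).eq_or_lt with rfl | hlt'
        · have ha : a ≤ M := by omega
          have := down (M - a) (a - 1)
          rw [Nat.sub_add_cancel hpos] at this
          exact this (by rwa [show a - 1 + (M - a) + 1 = M by omega])
        · obtain rfl : a = 1 := by omega
          obtain ⟨x, hx⟩ := ht.boxNonempty 0 c' hlt
          have h3 := ht.row_le hlt' hx h1
          have h4 := (ht.entryBounds _ _ _ hx).1
          obtain rfl : x = 1 := by omega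
          exact hx
    | succ r => exact tail _ r

theorem consRow_injective {m m' L : ℕ} {t' : Filling} (h0 : L = 0 → m = m')
    (h : consRow m L t = consRow m' L t') : m = m' ∧ t = t' := by
  constructor
  · rcases Nat.eq_zero_or_pos L with hL | hL
    · exact h0 hL
    · have h1 : ∀ a, a ∈ consRow m L t 0 (L - 1) ↔ a ∈ consRow m' L t' 0 (L - 1) := by
        rw [h]; exact fun _ => Iff.rfl
      simp only [mem_consRow_zero] at h1
      have h2 := (h1 (m + 1)).1 (by omega)
      have h3 := (h1 (m' + 1)).2 (by omega)
      omega
  · funext r c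
    have h1 : consRow m L t (r + 1) c = consRow m' L t' (r + 1) c := by rw [h]
    exact Finset.image_injective (add_left_injective 1) h1

/-- Deleting the first row of a dominant tableau. -/
theorem domCount_succ (hlam : IsPartitionShape (n + 1) lam) {mu : ℕ → ℕ}
    (hmu : IsPartitionShape (n + 1) mu) :
    domCount (n + 1) lam 0 (fun k => mu k) =
      if lam 0 = mu 0 then ∑ m ∈ Finset.range (n + 1),
        domCount n (fun r => lam (r + 1)) (oneSeq m) (fun k => mu (k + 1)) else 0 := by
  split_ifs with h0
  · unfold domCount
    rw [← Finset.card_sigma]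
    symm
    have pos : ∀ m t, m ≤ n → (∀ j, j < n → oneSeq m j + colCount t (lam 1) (j + 1) 0 =
        (mu (j + 1) : ℤ)) → 1 ≤ m → colCount t (lam 1) 1 0 < lam 0 := by
      intro m t hm h h1
      have h2 := h 0 (by omega)
      rw [oneSeq, if_pos (by omega)] at h2
      have h3 := hmu.1 0
      rw [zero_add] at h2 h3
      omega
    refine Finset.card_bij (fun p _ => consRow p.1 (lam 0) p.2) ?_ ?_ ?_
    · rintro ⟨m, t⟩ h
      simp only [Finset.mem_sigma, Finset.mem_range, Finset.mem_filter, mem_svts hlam.tail] at h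
      obtain ⟨hm, ht, hd, hw⟩ := h
      have hm : m ≤ n := by omega
      have hp := pos m t hm hw
      have hs := isSVT_consRow_of_dominant hlam hm ht hd hp
      rw [Finset.mem_filter, mem_svts hlam]
      exact ⟨hs, (dominant_consRow_iff hlam hs hm).2 hd,
        (content_consRow_iff hlam hs hm (by omega)).2 ⟨by rw [h0], hw⟩⟩
    · rintro ⟨m, t⟩ h ⟨m', t'⟩ h' heq
      simp only [Finset.mem_sigma, Finset.mem_range, Finset.mem_filter] at h h'
      have hp := pos m t (by omega) h.2.2.2
      have hp' := pos m' t' (by omega) h'.2.2.2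
      dsimp only at hp hp' heq h h'
      obtain ⟨rfl, rfl⟩ := consRow_injective (by omega) heq
      rfl
    · intro t h
      rw [Finset.mem_filter, mem_svts hlam] at h
      obtain ⟨ht, hd, hw⟩ := h
      obtain ⟨m, t', hm, hm0, rfl⟩ := exists_eq_consRow hlam ht hd
      refine ⟨⟨m, t'⟩, ?_, rfl⟩
      simp only [Finset.mem_sigma, Finset.mem_range, Finset.mem_filter, mem_svts hlam.tail]
      exact ⟨by omega, ((isSVT_consRow_iff hlam hm).1 ht).1,
        (dominant_consRow_iff hlam ht hm).1 hd, ((content_consRow_iff hlam ht hm hm0).1 hw).2⟩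
  · rw [domCount, Finset.card_eq_zero, Finset.filter_eq_empty_iff]
    rintro t ht ⟨hd, hw⟩
    rw [mem_svts hlam] at ht
    obtain ⟨m, t', hm, hm0, rfl⟩ := exists_eq_consRow hlam ht hd
    have := ((content_consRow_iff hlam ht hm hm0).1 hw).1
    exact h0 (by exact_mod_cast this)

end FirstRow

section Flagged

variable {n : ℕ} {lam mu : ℕ → ℕ}

theorem finite_isFlaggedIncreasing (hmu : IsPartitionShape n mu) :
    {F : ℕ → ℕ → ℕ | IsFlaggedIncreasing lam mu F}.Finite := by
  refine (finite_setOf_supported (Finset.finite_toSet (Finset.range (n + 1)))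
    0 n (mu 0)).subset fun F hF => ?_
  have out : ∀ r c, ¬ (r < n ∧ c < mu 0) → F r c = 0 := by
    refine fun r c h => hF.2.1 r c fun hc => h ⟨?_, hc.2.trans_le (hmu.antitone (Nat.zero_le r))⟩
    by_contra hr
    rw [hmu.2 r (by omega)] at hc
    omega
  refine ⟨fun r c => ?_, out⟩
  rw [Finset.mem_coe, Finset.mem_range]
  by_contra hlt
  by_cases h : lam r ≤ c ∧ c < mu r
  · have := hF.1 r c h.1 h.2
    have := out r c (by omega)
    omega
  · have := hF.2.1 r c h
    omega

/-- The finite set of flagged increasing tableaux of shape `mu / lam`, empty if `lam` is not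
contained in `mu`. -/
def flaggedTableaux (lam mu : ℕ → ℕ) : Finset (ℕ → ℕ → ℕ) :=
  if h : {F : ℕ → ℕ → ℕ | (∀ r, lam r ≤ mu r) ∧ IsFlaggedIncreasing lam mu F}.Finite then
    h.toFinset else ∅

theorem mem_flaggedTableaux (hmu : IsPartitionShape n mu) {F : ℕ → ℕ → ℕ} :
    F ∈ flaggedTableaux lam mu ↔ (∀ r, lam r ≤ mu r) ∧ IsFlaggedIncreasing lam mu F := by
  rw [flaggedTableaux, dif_pos ((finite_isFlaggedIncreasing hmu).subset fun F hF => hF.2)]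
  simp

/-- Remove from the rows `2, 3, …` of `mu` the last boxes of those indexed by `S`, and delete the
first row. -/
def removeStrip (mu : ℕ → ℕ) (S : Finset (Fin n)) (r : ℕ) : ℕ :=
  (mu (r + 1) - indSeq S r).toNat

theorem indSeq_eq_zero_or_one (S : Finset (Fin n)) (k : ℕ) : indSeq S k = 0 ∨ indSeq S k = 1 := by
  unfold indSeq
  split_ifs <;> simp

theorem coe_removeStrip (S : Finset (Fin n))
    (h : IsDominantSeq n (fun k => mu (k + 1) - indSeq S k)) (r : ℕ) :
    (removeStrip mu S r : ℤ) = mu (r + 1) - indSeq S r := by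
  refine Int.toNat_of_nonneg ?_
  obtain hr | hr := lt_or_ge r n
  · exact h.2 r hr
  · rw [indSeq, if_neg (by rintro ⟨h, _⟩; omega)]
    omega

theorem isPartitionShape_removeStrip (hmu : IsPartitionShape (n + 1) mu) (S : Finset (Fin n))
    (h : IsDominantSeq n (fun k => mu (k + 1) - indSeq S k)) :
    IsPartitionShape n (removeStrip mu S) := by
  have h0 : ∀ r, n ≤ r → removeStrip mu S r = 0 := by
    intro r hr
    have h1 := coe_removeStrip S h r
    rw [hmu.2 (r + 1) (by omega), indSeq, if_neg (by rintro ⟨h, _⟩; omega)] at h1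
    simpa using h1
  refine ⟨fun r => ?_, h0⟩
  obtain hr | hr := lt_or_ge (r + 1) n
  · have h1 := h.1 r hr
    simp only [← coe_removeStrip S h] at h1
    exact_mod_cast h1
  · rw [h0 _ hr]
    exact Nat.zero_le _

/-- Add to `F` an empty first row, and boxes with the maximal possible entries at the ends of
the rows with `e r = 1`. -/
def consFlag (mu : ℕ → ℕ) (e : ℕ → ℤ) (F : ℕ → ℕ → ℕ) : ℕ → ℕ → ℕ
  | 0, _ => 0
  | r + 1, c => if e r = 1 ∧ c + 1 = mu (r + 1) then r + 1 else F r c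

theorem IsFlaggedIncreasing.le {F : ℕ → ℕ → ℕ} (hF : IsFlaggedIncreasing lam mu F) (r c : ℕ) :
    F r c ≤ r := by
  by_cases h : lam r ≤ c ∧ c < mu r
  · exact (hF.1 r c h.1 h.2).2
  · rw [hF.2.1 r c h]
    exact Nat.zero_le _

theorem isFlaggedIncreasing_consFlag {e : ℕ → ℤ} {θ : ℕ → ℕ} {F : ℕ → ℕ → ℕ}
    (he : ∀ k, e k = 0 ∨ e k = 1) (hθ : ∀ r, (θ r : ℤ) = mu (r + 1) - e r)
    (hθa : ∀ r, θ (r + 1) ≤ θ r) (h0 : lam 0 = mu 0) (hle : ∀ r, lam (r + 1) ≤ θ r)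
    (hF : IsFlaggedIncreasing (fun r => lam (r + 1)) θ F) :
    IsFlaggedIncreasing lam mu (consFlag mu e F) := by
  refine ⟨fun r c h1 h2 => ?_, fun r c h => ?_, fun r c h1 h2 => ?_, fun r c h1 h2 h3 h4 => ?_⟩
  · cases r with
    | zero => omega
    | succ r =>
      have := he r
      have := hθ r
      rw [consFlag]
      split_ifs with h
      · omega
      · have := hF.1 r c h1 (by omega)
        omega
  · cases r with
    | zero => rfl
    | succ r =>
      have := he r
      have := hθ r
      have := hle r
      rw [consFlag, if_neg (by omega)]
      refine hF.2.1 r c fun h' => h ⟨h'.1, ?_⟩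
      omega
  · cases r with
    | zero => omega
    | succ r =>
      have := he r
      have := hθ r
      rw [consFlag, consFlag, if_neg (by omega)]
      split_ifs with h
      · exact Nat.lt_succ_of_le (hF.le r c)
      · exact hF.2.2.1 r c h1 (by omega)
  · cases r with
    | zero => omega
    | succ r =>
      have := he r
      have := hθ r
      have := he (r + 1)
      have := hθ (r + 1)
      have := hθa r
      have hr := hF.le r c
      rw [consFlag, consFlag]
      split_ifs with h5 h6 h6
      · omega
      · omega
      · omega
      · exact hF.2.2.2 r c h1 (by omega) h3 (by omega)

/-- The rows of a flagged increasing tableau which contain their maximal possible entry. -/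
def maxRows (n : ℕ) (F : ℕ → ℕ → ℕ) : Finset (Fin n) :=
  Finset.univ.filter (fun r => ∃ c, F (r + 1) c = r + 1)

theorem mem_maxRows {F : ℕ → ℕ → ℕ} {r : Fin n} :
    r ∈ maxRows n F ↔ ∃ c, F (r + 1) c = r + 1 := by
  simp [maxRows]

theorem maxRows_consFlag {S : Finset (Fin n)} {F : ℕ → ℕ → ℕ} (hF : ∀ r c, F r c ≤ r)
    (hS : ∀ r, 0 ≤ (mu (r + 1) : ℤ) - indSeq S r) :
    maxRows n (consFlag mu (indSeq S) F) = S := by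
  ext r
  have h1 := indSeq_coe S r
  have h2 := hS r
  simp only [mem_maxRows, consFlag]
  constructor
  · rintro ⟨c, hc⟩
    by_contra hr
    rw [if_neg hr] at h1
    rw [if_neg (by omega)] at hc
    have := hF r c
    omega
  · intro hr
    rw [if_pos hr] at h1
    exact ⟨mu (r + 1) - 1, if_pos (by omega)⟩

theorem eq_of_consFlag_eq {e : ℕ → ℤ} {F F' : ℕ → ℕ → ℕ}
    (hF : ∀ r c, e r = 1 → c + 1 = mu (r + 1) → F r c = 0)
    (hF' : ∀ r c, e r = 1 → c + 1 = mu (r + 1) → F' r c = 0)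
    (h : consFlag mu e F = consFlag mu e F') : F = F' := by
  funext r c
  have h1 : consFlag mu e F (r + 1) c = consFlag mu e F' (r + 1) c := by rw [h]
  simp only [consFlag] at h1
  split_ifs at h1 with h2
  · rw [hF r c h2.1 h2.2, hF' r c h2.1 h2.2]
  · exact h1

theorem exists_eq_consFlag (hlam : IsPartitionShape (n + 1) lam)
    (hmu : IsPartitionShape (n + 1) mu) (hle : ∀ r, lam r ≤ mu r) {F : ℕ → ℕ → ℕ}
    (hF : IsFlaggedIncreasing lam mu F) :
    lam 0 = mu 0 ∧ ∃ (S : Finset (Fin n)) (F' : ℕ → ℕ → ℕ),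
      IsDominantSeq n (fun k => mu (k + 1) - indSeq S k) ∧
      (∀ r, lam (r + 1) ≤ removeStrip mu S r) ∧
      IsFlaggedIncreasing (fun r => lam (r + 1)) (removeStrip mu S) F' ∧
      F = consFlag mu (indSeq S) F' := by
  have h0 : lam 0 = mu 0 := by
    refine (hle 0).antisymm ?_
    by_contra h
    have := hF.1 0 (lam 0) le_rfl (by omega)
    omega
  have hlast : ∀ {r c}, F (r + 1) c = r + 1 → lam (r + 1) ≤ c ∧ c + 1 = mu (r + 1) := by
    intro r c h
    have hbox : lam (r + 1) ≤ c ∧ c < mu (r + 1) := by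
      by_contra hno
      have := hF.2.1 _ _ hno
      omega
    refine ⟨hbox.1, ?_⟩
    by_contra hne
    have h1 := hF.2.2.1 (r + 1) c hbox.1 (by omega)
    have h2 := hF.le (r + 1) (c + 1)
    omega
  set S := maxRows n F with hSdef
  have he := indSeq_eq_zero_or_one S
  have hS : ∀ r, indSeq S r = 1 ↔ ∃ c, F (r + 1) c = r + 1 := by
    intro r
    obtain hr | hr := lt_or_ge r n
    · have := indSeq_coe S ⟨r, hr⟩
      simp only at this
      rw [this]
      simp [hSdef, mem_maxRows]
    · rw [indSeq, if_neg (by rintro ⟨h, _⟩; omega)]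
      simp only [zero_ne_one, false_iff, not_exists]
      intro c hc
      have := (hlast hc).2
      rw [hmu.2 (r + 1) (by omega)] at this
      omega
  have hS' : ∀ r, indSeq S r = 1 → lam (r + 1) < mu (r + 1) ∧
      F (r + 1) (mu (r + 1) - 1) = r + 1 := by
    intro r h
    obtain ⟨c, hc⟩ := (hS r).1 h
    have := hlast hc
    refine ⟨by omega, ?_⟩
    rwa [← this.2, Nat.add_sub_cancel]
  have hdom : IsDominantSeq n (fun k => mu (k + 1) - indSeq S k) := by
    refine ⟨fun j hj => ?_, fun j hj => ?_⟩
    · have h1 := hmu.1 (j + 1)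
      have h2 := hlam.1 (j + 1)
      have h3 := he (j + 1)
      rcases he j with h | h
      · simp only [h]
        omega
      · simp only [h]
        obtain ⟨h4, h5⟩ := hS' j h
        rcases h1.eq_or_lt with h6 | h6
        · have h7 := hF.2.2.2 (j + 1) (mu (j + 1) - 1) (by omega) (by omega) (by omega) (by omega)
          have h8 := hF.le (j + 1 + 1) (mu (j + 1) - 1)
          have := (hS (j + 1)).2 ⟨mu (j + 1) - 1, by omega⟩
          rw [this]
          omega
        · omega
    · rcases he j with h | h
      · simp only [h]
        omega
      · simp only [h]
        have := hS' j h
        omega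
  have hθ := coe_removeStrip S hdom
  have hne : ∀ r c, c < removeStrip mu S r → F (r + 1) c ≠ r + 1 := by
    intro r c hc h
    have h1 := hlast h
    have h2 := (hS r).2 ⟨c, h⟩
    have h3 := hθ r
    omega
  refine ⟨h0, S, fun r c => if F (r + 1) c = r + 1 then 0 else F (r + 1) c, hdom,
    fun r => ?_, ⟨fun r c h1 h2 => ?_, fun r c h => ?_, fun r c h1 h2 => ?_,
      fun r c h1 h2 h3 h4 => ?_⟩, ?_⟩
  · have h1 := hθ r
    have h2 := hle (r + 1)
    rcases he r with h | h
    · omega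
    · have := hS' r h
      omega
  · have h3 := hne r c h2
    have h4 := hθ r
    have h5 := he r
    dsimp only
    rw [if_neg h3]
    have := hF.1 (r + 1) c h1 (by omega)
    omega
  · dsimp only
    split_ifs with h1
    · rfl
    · refine hF.2.1 _ _ fun h2 => h ⟨h2.1, ?_⟩
      have h4 := hθ r
      rcases he r with h5 | h5
      · omega
      · have h6 := (hS' r h5).2
        by_contra h7
        rw [show mu (r + 1) - 1 = c by omega] at h6
        exact h1 h6
  · have h4 := hθ r
    have h5 := he r
    dsimp only
    rw [if_neg (hne _ _ h2), if_neg (hne _ _ (by omega))]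
    exact hF.2.2.1 (r + 1) c h1 (by omega)
  · have h5 := hθ r
    have h6 := he r
    have h7 := hθ (r + 1)
    have h8 := he (r + 1)
    dsimp only
    rw [if_neg (hne _ _ h2), if_neg (hne _ _ h4)]
    exact hF.2.2.2 (r + 1) c h1 (by omega) h3 (by omega)
  · funext r c
    cases r with
    | zero => exact hF.2.1 0 c (by omega)
    | succ r =>
      rw [consFlag]
      split_ifs with h1 h2
      · have := (hS' r h1.1).2
        rwa [← h1.2, Nat.add_sub_cancel] at this
      · exact absurd ⟨(hS r).2 ⟨c, h2⟩, (hlast h2).2⟩ h1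
      · rfl

/-- Deleting the first row and the maximal entries of a flagged increasing tableau. -/
theorem card_flaggedTableaux_succ (hlam : IsPartitionShape (n + 1) lam)
    (hmu : IsPartitionShape (n + 1) mu) :
    (flaggedTableaux lam mu).card = if lam 0 = mu 0 then
      ∑ S : Finset (Fin n) with IsDominantSeq n (fun k => mu (k + 1) - indSeq S k),
        (flaggedTableaux (fun r => lam (r + 1)) (removeStrip mu S)).card else 0 := by
  split_ifs with h0
  · rw [← Finset.card_sigma]
    symm
    have mem : ∀ {S : Finset (Fin n)} {F : ℕ → ℕ → ℕ},
        (⟨S, F⟩ : (_ : Finset (Fin n)) × (ℕ → ℕ → ℕ)) ∈ (Finset.univ.filter (fun S : Finset (Fin n) =>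
          IsDominantSeq n (fun k => mu (k + 1) - indSeq S k))).sigma
          (fun S => flaggedTableaux (fun r => lam (r + 1)) (removeStrip mu S)) ↔
        IsDominantSeq n (fun k => mu (k + 1) - indSeq S k) ∧
          (∀ r, lam (r + 1) ≤ removeStrip mu S r) ∧
          IsFlaggedIncreasing (fun r => lam (r + 1)) (removeStrip mu S) F := by
      intro S F
      simp only [Finset.mem_sigma, Finset.mem_filter, Finset.mem_univ, true_and]
      exact and_congr_right fun h => mem_flaggedTableaux (isPartitionShape_removeStrip hmu S h)
    refine Finset.card_bij (fun p _ => consFlag mu (indSeq p.1) p.2) ?_ ?_ ?_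
    · rintro ⟨S, F⟩ h
      obtain ⟨hd, hle, hF⟩ := mem.1 h
      have hθ := coe_removeStrip S hd
      have he := indSeq_eq_zero_or_one S
      rw [mem_flaggedTableaux hmu]
      refine ⟨fun r => ?_, isFlaggedIncreasing_consFlag he hθ
        (isPartitionShape_removeStrip hmu S hd).1 h0 hle hF⟩
      cases r with
      | zero => exact h0.le
      | succ r =>
        have h1 := he r
        have h2 := hθ r
        have h3 := hle r
        omega
    · rintro ⟨S, F⟩ h ⟨S', F'⟩ h' heq
      obtain ⟨hd, hle, hF⟩ := mem.1 h
      obtain ⟨hd', hle', hF'⟩ := mem.1 h'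
      have hθ := coe_removeStrip S hd
      have hθ' := coe_removeStrip S' hd'
      dsimp only at heq
      have hS : S = S' := by
        rw [← maxRows_consFlag (mu := mu) (S := S) hF.le (fun r => by rw [← hθ]; omega), heq,
          maxRows_consFlag hF'.le (fun r => by rw [← hθ']; omega)]
      subst hS
      have hz : ∀ r c, indSeq S r = 1 → c + 1 = mu (r + 1) →
          ¬ (lam (r + 1) ≤ c ∧ c < removeStrip mu S r) := by
        intro r c h1 h2
        have := hθ r
        omega
      rw [eq_of_consFlag_eq (fun r c h1 h2 => hF.2.1 r c (hz r c h1 h2))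
        (fun r c h1 h2 => hF'.2.1 r c (hz r c h1 h2)) heq]
    · intro F h
      obtain ⟨hle, hF⟩ := (mem_flaggedTableaux hmu).1 h
      obtain ⟨_, S, F', hd, hle', hF', rfl⟩ := exists_eq_consFlag hlam hmu hle hF
      exact ⟨⟨S, F'⟩, mem.2 ⟨hd, hle', hF'⟩, rfl⟩
  · rw [Finset.card_eq_zero, Finset.eq_empty_iff_forall_notMem]
    intro F h
    obtain ⟨hle, hF⟩ := (mem_flaggedTableaux hmu).1 h
    exact h0 (exists_eq_consFlag hlam hmu hle hF).1

theorem domCount_zero_eq_card_flaggedTableaux (hlam : IsPartitionShape n lam)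
    (hmu : IsPartitionShape n mu) :
    domCount n lam 0 (fun k => mu k) = (flaggedTableaux lam mu).card := by
  induction n generalizing lam mu with
  | zero =>
    have hl : ∀ r, lam r = 0 := fun r => hlam.2 r (Nat.zero_le r)
    have hm : ∀ r, mu r = 0 := fun r => hmu.2 r (Nat.zero_le r)
    have h1 : domCount 0 lam 0 (fun k => mu k) = 1 := by
      rw [domCount, Finset.card_eq_one]
      refine ⟨fun _ _ => ∅, ?_⟩
      ext t
      simp only [Finset.mem_filter, Finset.mem_singleton, mem_svts hlam]
      constructor
      · rintro ⟨ht, -⟩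
        funext r c
        exact ht.emptyOutside r c (by simp [hl])
      · rintro rfl
        refine ⟨⟨?_, ?_, ?_, ?_, ?_⟩, fun j hj => ?_, fun j hj => ?_⟩ <;> simp_all
    have h2 : (flaggedTableaux lam mu).card = 1 := by
      rw [Finset.card_eq_one]
      refine ⟨fun _ _ => 0, ?_⟩
      ext F
      simp only [Finset.mem_singleton, mem_flaggedTableaux hmu]
      constructor
      · rintro ⟨-, hF⟩
        funext r c
        exact hF.2.1 r c (by simp [hm])
      · rintro rfl
        refine ⟨?_, ?_, ?_, ?_, ?_⟩ <;> simp_all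
    rw [h1, h2]
  | succ n ih =>
    rw [domCount_succ hlam hmu, card_flaggedTableaux_succ hlam hmu]
    refine if_congr Iff.rfl ?_ rfl
    rw [sum_domCount_oneSeq hlam.tail]
    · refine Finset.sum_congr rfl fun S hS => ?_
      have hd := (Finset.mem_filter.1 hS).2
      rw [← ih hlam.tail (isPartitionShape_removeStrip hmu S hd)]
      congr 1
      funext k
      exact (coe_removeStrip S hd k).symm
    · exact ⟨fun j _ => Int.ofNat_le.2 (hmu.1 (j + 1)), fun j _ => by positivity⟩

theorem natCard_yamanouchi (hlam : IsPartitionShape n lam) (hmu : IsPartitionShape n mu) :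
    Nat.card {t : Filling // IsSVT n lam t ∧ IsYamanouchi n lam t ∧
      ∀ r, wt n lam t (r + 1) = mu r} = domCount n lam 0 (fun k => mu k) := by
  rw [domCount]
  refine Nat.subtype_card _ fun t => ?_
  rw [Finset.mem_filter, mem_svts hlam]
  refine and_congr_right fun ht => ?_
  rw [isYamanouchi_iff hlam ht]
  refine and_congr ?_ ?_
  · simp only [Dominant, Pi.zero_apply, zero_add]
    constructor
    · intro h i hi hin c
      obtain ⟨j, rfl⟩ : ∃ j, i = j + 1 := ⟨i - 1, by omega⟩
      exact_mod_cast h j hin c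
    · intro h j hj c
      exact_mod_cast h (j + 1) (by omega) hj c
  · simp only [wt_eq_colCount hlam ht, Pi.zero_apply, zero_add, Nat.cast_inj]
    refine ⟨fun h r => ?_, fun h j _ => h j⟩
    obtain hr | hr := lt_or_ge r n
    · exact h r hr
    · rw [hmu.2 r hr, colCount, Finset.card_eq_zero, Finset.filter_eq_empty_iff]
      rintro c _ ⟨r', hr'⟩
      have := ht.entryBounds _ _ _ hr'
      omega

end Flagged

/-- the number of Yamanouchi semistandard set-valued tableaux in
`SVT^n(λ)` of weight `μ` equals the number of flagged increasing tableaux of shape `μ/λ`;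
in particular it is zero unless `λ ⊆ μ`. -/
theorem yamanouchi_eq_flagged (n : ℕ) (lam mu : ℕ → ℕ)
    (hlam : IsPartitionShape n lam) (hmu : IsPartitionShape n mu) :
    ((∀ r, lam r ≤ mu r) →
      Nat.card {t : Filling // IsSVT n lam t ∧ IsYamanouchi n lam t ∧
          ∀ r, wt n lam t (r + 1) = mu r} =
        Nat.card {F : ℕ → ℕ → ℕ // IsFlaggedIncreasing lam mu F}) ∧
    (¬ (∀ r, lam r ≤ mu r) →
      Nat.card {t : Filling // IsSVT n lam t ∧ IsYamanouchi n lam t ∧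
          ∀ r, wt n lam t (r + 1) = mu r} = 0) := by
  rw [natCard_yamanouchi hlam hmu, domCount_zero_eq_card_flaggedTableaux hlam hmu]
  refine ⟨fun hle => ?_, fun hle => ?_⟩
  · refine (Nat.subtype_card _ fun F => ?_).symm
    rw [mem_flaggedTableaux hmu]
    exact and_iff_right hle
  · rw [Finset.card_eq_zero, Finset.eq_empty_iff_forall_notMem]
    exact fun F hF => hle ((mem_flaggedTableaux hmu).1 hF).1

end SVTCrystal

end
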